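/- arXiv:1103.3732 — 4 statements merged into one kernel-verified Lean document; each statement's English description precedes it below -/
import Mathlib

section
/- Every proper circular-arc (PCA) model is equivalent to a normal proper circular-arc (NPCA) model; that is, for every PCA model M there exists a CA model that is simultaneously normal and proper whose intersection graph is isomorphic to the intersection graph of M. Consequently, every graph admitting a PCA model admits an NPCA model. -/
open Set

noncomputable section

instance : Fact ((0:ℝ) < 1) := ⟨one_pos⟩

/-- A point on the circle (of circumference 1). -/
abbrev Circ : Type := AddCircle (1 : ℝ)

/-- An arc of the circle, described by its beginning point `s` and its ending point `t`
(the arc is traversed clockwise, i.e. in the positive circular direction, from `s` to `t`). -/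
structure Arc where
  s : Circ
  t : Circ

/-- The set of points of the open arc: the points strictly between `s` and `t`
in the circular order. -/
def Arc.pts (A : Arc) : Set Circ := {x | sbtw A.s x A.t}

/-- The length of an arc: the representative in `(0, 1]` of `t - s`. -/
def Arc.length (A : Arc) : ℝ := ((AddCircle.equivIoc (1:ℝ) 0) (A.t - A.s) : ℝ)

/-- A circular-arc (CA) model: a finite family of arcs of the circle such that all
endpoints of the arcs are pairwise distinct (in particular each arc has two distinct
endpoints, hence no arc covers the whole circle). -/
structure CAModel (V : Type) [Fintype V] where
  arc : V → Arc
  endpoints_distinct : Function.Injective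
    (fun p : V × Bool => if p.2 then (arc p.1).s else (arc p.1).t)

namespace CAModel

variable {V : Type} [Fintype V]

/-- The arcs of `u` and `v` intersect. -/
def Inter (M : CAModel V) (u v : V) : Prop := ((M.arc u).pts ∩ (M.arc v).pts).Nonempty

/-- The intersection graph of the model: two distinct arcs are adjacent iff they have
nonempty intersection. -/
def interGraph (M : CAModel V) : SimpleGraph V :=
  SimpleGraph.fromRel fun u v => M.Inter u v

/-- `M` is a model of the graph `G`: the arcs are in correspondence with the vertices of `G`
and two vertices are adjacent iff their arcs are distinct and intersect. -/
def IsModelOf (M : CAModel V) (G : SimpleGraph V) : Prop :=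
  ∀ u v, G.Adj u v ↔ u ≠ v ∧ M.Inter u v

/-- Helly model: every subfamily of pairwise intersecting arcs has a common point. -/
def Helly (M : CAModel V) : Prop :=
  ∀ S : Set V, (∀ u ∈ S, ∀ v ∈ S, M.Inter u v) → ∃ p : Circ, ∀ v ∈ S, p ∈ (M.arc v).pts

/-- Normal model: no two arcs together cover the whole circle. -/
def Normal (M : CAModel V) : Prop :=
  ∀ u v : V, u ≠ v → (M.arc u).pts ∪ (M.arc v).pts ≠ Set.univ

/-- No three arcs together cover the whole circle. -/
def NoThreeCover (M : CAModel V) : Prop :=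
  ∀ u v w : V, u ≠ v → u ≠ w → v ≠ w →
    (M.arc u).pts ∪ (M.arc v).pts ∪ (M.arc w).pts ≠ Set.univ

/-- Proper model: no arc is properly contained in another arc. -/
def Proper (M : CAModel V) : Prop :=
  ∀ u v : V, u ≠ v → ¬ (M.arc u).pts ⊂ (M.arc v).pts

/-- Unit model: all arcs have the same length. -/
def IsUnit (M : CAModel V) : Prop :=
  ∀ u v : V, (M.arc u).length = (M.arc v).length

/-- Interval model: some point of the circle is covered by no arc. -/
def IsIntervalModel (M : CAModel V) : Prop :=
  ∃ p : Circ, ∀ v : V, p ∉ (M.arc v).pts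

/-- A universal arc: it intersects every other arc of the model. -/
def UniversalArc (M : CAModel V) (v : V) : Prop :=
  ∀ w, w ≠ v → M.Inter v w

end CAModel

section GraphClasses

variable {V : Type} [Fintype V]

def IsCAGraph (G : SimpleGraph V) : Prop := ∃ M : CAModel V, M.IsModelOf G
def IsHCAGraph (G : SimpleGraph V) : Prop := ∃ M : CAModel V, M.Helly ∧ M.IsModelOf G
def IsNCAGraph (G : SimpleGraph V) : Prop := ∃ M : CAModel V, M.Normal ∧ M.IsModelOf G
def IsNHCAGraph (G : SimpleGraph V) : Prop :=
  ∃ M : CAModel V, M.Normal ∧ M.Helly ∧ M.IsModelOf G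
def IsPCAGraph (G : SimpleGraph V) : Prop := ∃ M : CAModel V, M.Proper ∧ M.IsModelOf G
def IsNPCAGraph (G : SimpleGraph V) : Prop :=
  ∃ M : CAModel V, M.Normal ∧ M.Proper ∧ M.IsModelOf G
def IsPHCAGraph (G : SimpleGraph V) : Prop :=
  ∃ M : CAModel V, M.Proper ∧ M.Helly ∧ M.IsModelOf G
def IsUCAGraph (G : SimpleGraph V) : Prop := ∃ M : CAModel V, M.IsUnit ∧ M.IsModelOf G
def IsUHCAGraph (G : SimpleGraph V) : Prop :=
  ∃ M : CAModel V, M.IsUnit ∧ M.Helly ∧ M.IsModelOf G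
def IsIntervalGraph (G : SimpleGraph V) : Prop :=
  ∃ M : CAModel V, M.IsIntervalModel ∧ M.IsModelOf G

end GraphClasses
/-! ### Some small graphs -/

/-- The claw `K_{1,3}`: vertex `0` is adjacent to `1`, `2`, `3`, which are pairwise
non-adjacent. -/
def claw : SimpleGraph (Fin 4) := SimpleGraph.fromRel fun u _ => u = 0

/-- The `n`-wheel `W_n`: a chordless cycle on `n` vertices plus one extra vertex adjacent
to all of them (intended for `n ≥ 4`). -/
def wheel (n : ℕ) : SimpleGraph (Fin n ⊕ Unit) :=
  SimpleGraph.fromRel fun u v =>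
    (∃ x, u = Sum.inr x) ∨
    (∃ i j : Fin n, u = Sum.inl i ∧ v = Sum.inl j ∧ ((i : ℕ) + 1) % n = (j : ℕ))

/-- The 3-sun `S_3`: vertices `0,1,2` (the `v_i`'s) are pairwise adjacent, vertices
`3,4,5` (the `w_i`'s) are pairwise non-adjacent, and `w_i` is adjacent exactly to
`v_i` and `v_{i+1 (mod 3)}`. -/
def sun3 : SimpleGraph (Fin 6) :=
  SimpleGraph.fromRel fun u v =>
    ((u : ℕ) < 3 ∧ (v : ℕ) < 3) ∨
    (3 ≤ (u : ℕ) ∧ ((v : ℕ) = (u : ℕ) - 3 ∨ (v : ℕ) = ((u : ℕ) - 2) % 3))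

/-- The tent: the complement of the 3-sun. -/
def tent : SimpleGraph (Fin 6) := sun3ᶜ

/-- The `n`-rising sun `R_n` (intended for `n ≥ 4`): vertices `inl 0, …, inl (n-1)`
are `v_1, …, v_n` where `v_2, …, v_{n-1}` form a path in this order and `v_1`, `v_n`
are adjacent to all the `v`'s; `inr 0 = w_1` is adjacent exactly to `v_1, v_2`;
`inr 1 = w_{n-1}` is adjacent exactly to `v_{n-1}, v_n`; and `inr 2 = w_n` is adjacent
exactly to `v_n, v_1`. -/
def risingSun (n : ℕ) : SimpleGraph (Fin n ⊕ Fin 3) :=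
  SimpleGraph.fromRel fun u v =>
    match u, v with
    | Sum.inl a, Sum.inl b => (a : ℕ) = 0 ∨ (a : ℕ) = n - 1 ∨ (b : ℕ) = (a : ℕ) + 1
    | Sum.inr w, Sum.inl a =>
        ((w : ℕ) = 0 ∧ ((a : ℕ) = 0 ∨ (a : ℕ) = 1)) ∨
        ((w : ℕ) = 1 ∧ ((a : ℕ) = n - 2 ∨ (a : ℕ) = n - 1)) ∨
        ((w : ℕ) = 2 ∧ ((a : ℕ) = n - 1 ∨ (a : ℕ) = 0))
    | _, _ => False

/-- The umbrella: a path `0,1,2,3,4`, a vertex `5` adjacent to all of `0,…,4`, and a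
vertex `6` adjacent only to `2`. -/
def umbrella : SimpleGraph (Fin 7) :=
  SimpleGraph.fromRel fun u v =>
    ((u : ℕ) < 5 ∧ (v : ℕ) = (u : ℕ) + 1 ∧ (v : ℕ) < 5) ∨
    ((u : ℕ) = 5 ∧ (v : ℕ) < 5) ∨
    ((u : ℕ) = 6 ∧ (v : ℕ) = 2)

/-- Clockwise distance from `x` to `y` on the circle `[0,1)`. -/
def dd (x y : ℝ) : ℝ := if x ≤ y then y - x else y - x + 1
/-- core -/
theorem exists_gap {ι : Type*} [Finite ι] (f : ι → ℝ) : ∃ δ > 0, ∀ i, f i ≠ 0 → δ ≤ |f i| := by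
  have h : ∀ i, ∃ δ > 0, (f i ≠ 0 → δ ≤ |f i|) := by
    intro i
    by_cases hi : f i = 0
    · exact ⟨1, one_pos, fun h => absurd hi h⟩
    · exact ⟨|f i|, abs_pos.mpr hi, fun _ => le_rfl⟩
  choose g hg hg' using h
  have := Fintype.ofFinite ι
  by_cases hne : Nonempty ι
  · obtain ⟨i, hi⟩ := Finite.exists_min g
    exact ⟨g i, hg i, fun j hj => (hi j).trans (hg' j hj)⟩
  · exact ⟨1, one_pos, fun i => absurd ⟨i⟩ hne⟩

theorem dd_self (x : ℝ) : dd x x = 0 := by simp [dd]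

theorem dd_add {x y : ℝ} (h : x ≠ y) : dd x y + dd y x = 1 := by
  unfold dd
  rcases lt_or_gt_of_ne h with h | h
  · rw [if_pos h.le, if_neg (not_le.mpr h)]; ring
  · rw [if_neg (not_le.mpr h), if_pos h.le]; ring

theorem dd_nonneg {x y : ℝ} (hx : x ∈ Set.Ico (0:ℝ) 1) (hy : y ∈ Set.Ico (0:ℝ) 1) : 0 ≤ dd x y := by
  obtain ⟨h1, h2⟩ := hx; obtain ⟨h3, h4⟩ := hy
  unfold dd; split_ifs <;> linarith

theorem dd_lt_one {x y : ℝ} (hx : x ∈ Set.Ico (0:ℝ) 1) (hy : y ∈ Set.Ico (0:ℝ) 1) : dd x y < 1 := by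
  obtain ⟨h1, h2⟩ := hx; obtain ⟨h3, h4⟩ := hy
  unfold dd; split_ifs <;> linarith

theorem dd_pos {x y : ℝ} (hx : x ∈ Set.Ico (0:ℝ) 1) (hy : y ∈ Set.Ico (0:ℝ) 1) (h : x ≠ y) :
    0 < dd x y := by
  have := dd_add h; have := dd_lt_one hy hx; linarith

/-- Additivity of the circular distance, up to one turn. -/
theorem dd_tri {x y : ℝ} (z : ℝ) (hx : x ∈ Set.Ico (0:ℝ) 1) (hy : y ∈ Set.Ico (0:ℝ) 1)
    (hz : z ∈ Set.Ico (0:ℝ) 1) :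
    (dd x y ≤ dd x z ∧ dd x z = dd x y + dd y z) ∨ (dd x z < dd x y ∧ dd x z + 1 = dd x y + dd y z) := by
  obtain ⟨h1, h2⟩ := hx; obtain ⟨h3, h4⟩ := hy; obtain ⟨h5, h6⟩ := hz
  unfold dd; split_ifs <;> first
    | (left; constructor <;> linarith)
    | (right; constructor <;> linarith)

theorem dd_inj {x y z : ℝ} (hx : x ∈ Set.Ico (0:ℝ) 1) (hy : y ∈ Set.Ico (0:ℝ) 1)
    (hz : z ∈ Set.Ico (0:ℝ) 1) (h : dd x y = dd x z) : y = z := by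
  obtain ⟨h1, h2⟩ := hx; obtain ⟨h3, h4⟩ := hy; obtain ⟨h5, h6⟩ := hz
  unfold dd at h; split_ifs at h <;> linarith

theorem exists_dd {x a : ℝ} (hx : x ∈ Set.Ico (0:ℝ) 1) (ha : a ∈ Set.Ico (0:ℝ) 1) :
    ∃ z ∈ Set.Ico (0:ℝ) 1, dd x z = a := by
  obtain ⟨h1, h2⟩ := hx; obtain ⟨h3, h4⟩ := ha
  by_cases h : x + a < 1
  · refine ⟨x + a, ⟨by linarith, h⟩, ?_⟩
    unfold dd; rw [if_pos (by linarith)]; ring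
  · refine ⟨x + a - 1, ⟨by linarith, by linarith⟩, ?_⟩
    unfold dd; rw [if_neg (by linarith)]; ring

theorem core {V : Type} [Fintype V] (x l : V → ℝ) (hx : ∀ u, x u ∈ Set.Ico (0:ℝ) 1)
    (hinj : Function.Injective x) (hl : ∀ u, 0 < l u) (hl1 : ∀ u, l u < 1)
    (hne : ∀ u v, l u ≠ dd (x u) (x v))
    (hp : ∀ u v, u ≠ v → l u < dd (x u) (x v) + l v) :
    ∃ l' : V → ℝ, (∀ u, 0 < l' u) ∧ (∀ u, l' u < 1) ∧ (∀ u v, l' u ≠ dd (x u) (x v)) ∧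
      (∀ u v, u ≠ v → l' u < dd (x u) (x v) + l' v) ∧
      (∀ u v, u ≠ v → ¬ (dd (x u) (x v) < l' u ∧ dd (x v) (x u) < l' v)) ∧
      (∀ u v, u ≠ v → ((dd (x u) (x v) < l u ∨ dd (x v) (x u) < l v) ↔
        (dd (x u) (x v) < l' u ∨ dd (x v) (x u) < l' v))) := by
  have hsum : ∀ u v, u ≠ v → dd (x u) (x v) + dd (x v) (x u) = 1 := fun u v h =>
    dd_add (fun e => h (hinj e))
  have hpos : ∀ u v, u ≠ v → 0 < dd (x u) (x v) := fun u v h =>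
    dd_pos (hx u) (hx v) (fun e => h (hinj e))
  have htri := fun u v w => dd_tri (x w) (hx u) (hx v)  (hx w)
  have hlt : ∀ u v, dd (x u) (x v) < 1 := fun u v => dd_lt_one (hx u) (hx v)
  have hnn : ∀ u v, 0 ≤ dd (x u) (x v) := fun u v => dd_nonneg (hx u) (hx v)
  obtain ⟨δ₁, hδ₁, hg1⟩ := exists_gap (fun p : V × V × V => dd (x p.1) (x p.2.1) - dd (x p.1) (x p.2.2))
  obtain ⟨δ₂, hδ₂, hg2⟩ := exists_gap (fun p : V × V => dd (x p.1) (x p.2) - 1 / 2)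
  obtain ⟨e, he, he1, he2, he3⟩ : ∃ e > 0, 2 * e < δ₁ ∧ e < δ₂ ∧ e < 1 / 4 := by
    refine ⟨min (min δ₁ δ₂) 1 / 5, by positivity, ?_, ?_, ?_⟩
    all_goals
      have h1 := min_le_left (min δ₁ δ₂) 1
      have h2 := min_le_right (min δ₁ δ₂) 1
      have h3 := min_le_left δ₁ δ₂
      have h4 := min_le_right δ₁ δ₂
      linarith
  have gap1 : ∀ u v w, dd (x u) (x v) < dd (x u) (x w) → dd (x u) (x v) + 2 * e < dd (x u) (x w) := by
    intro u v w h
    have := hg1 (u, v, w) (by simp only; linarith)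
    simp only [abs_of_neg (sub_neg.mpr h)] at this
    linarith
  have gap0 : ∀ u v, u ≠ v → 2 * e < dd (x u) (x v) := by
    intro u v h
    have := gap1 u u v (by rw [dd_self]; exact hpos u v h)
    rw [dd_self] at this; linarith
  have gap2 : ∀ u v, dd (x u) (x v) < 1 / 2 → dd (x u) (x v) + e < 1 / 2 := by
    intro u v h
    have := hg2 (u, v) (by simp only; linarith)
    simp only [abs_of_neg (sub_neg.mpr h)] at this
    linarith
  have gap3 : ∀ u v, 1 / 2 < dd (x u) (x v) → 1 / 2 + e < dd (x u) (x v) := by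
    intro u v h
    have := hg2 (u, v) (by simp only; linarith)
    simp only [abs_of_pos (sub_pos.mpr h)] at this
    linarith
  have hk : ∀ u, ∃ k : ℝ, (k = 1 ∨ ∃ v, v ≠ u ∧ dd (x v) (x u) < l v ∧ k = dd (x u) (x v)) ∧ k ≤ 1 ∧
      0 < k ∧ ∀ v, v ≠ u → dd (x v) (x u) < l v → k ≤ dd (x u) (x v) := by
    intro u
    classical
    by_cases hS : ((Finset.univ : Finset V).filter (fun v => v ≠ u ∧ dd (x v) (x u) < l v)).Nonempty
    · obtain ⟨v, hv, hm⟩ := Finset.exists_min_image _ (fun v => dd (x u) (x v)) hS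
      simp only [Finset.mem_filter, Finset.mem_univ, true_and] at hv hm
      exact ⟨_, Or.inr ⟨v, hv.1, hv.2, rfl⟩, (hlt _ _).le, hpos _ _ hv.1.symm, fun w h1 h2 => hm w ⟨h1, h2⟩⟩
    · refine ⟨1, Or.inl rfl, le_rfl, one_pos, fun v h1 h2 => absurd ⟨v, ?_⟩ hS⟩
      simp [h1, h2]
  choose k hk1 hkle hk0 hkm using hk
  have kgap : ∀ u v, dd (x u) (x v) < k u → dd (x u) (x v) < (1 - e) * k u := by
    intro u v h
    have h2 : dd (x u) (x v) + 2 * e ≤ k u := by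
      rcases hk1 u with h1 | ⟨w, hw, -, hw2⟩
      · rw [h1]
        by_cases huv : u = v
        · rw [huv, dd_self]; linarith
        · have := gap0 v u (Ne.symm huv); have := hsum u v huv; linarith
      · rw [hw2] at h ⊢; exact (gap1 _ _ _ h).le
    nlinarith [hkle u, hk0 u]
  have klip : ∀ u v, u ≠ v → k u ≤ dd (x u) (x v) + k v := by
    intro u v huv
    have h0 := hnn u v
    rcases hk1 v with h1 | ⟨w, hw, hw1, hw2⟩
    · linarith [hkle u]
    · rw [hw2]
      rcases htri u v w with ⟨h3, h4⟩ | ⟨h3, h4⟩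
      · rw [← h4]
        have hwu : w ≠ u := by
          rintro rfl; rw [dd_self] at h3; linarith [hpos w v huv]
        apply hkm u w hwu
        have := hsum u w hwu.symm
        have := hsum v w hw.symm
        linarith
      · linarith [hnn u w, hkle u]
  let b : V → ℝ := fun u => if x u < 1 / 2 then 1 / 2 + e else 1 / 2 - e
  have hb1 : ∀ u, 1 / 2 - e ≤ b u := by intro u; simp only [b]; split_ifs <;> linarith
  have hb2 : ∀ u, b u ≤ 1 / 2 + e := by intro u; simp only [b]; split_ifs <;> linarith
  have hbne : ∀ u v, b u ≠ dd (x u) (x v) := by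
    intro u v
    rcases lt_trichotomy (dd (x u) (x v)) (1/2) with h | h | h
    · have := gap2 u v h; have := hb1 u; intro; linarith
    · rw [h]; simp only [b]; split_ifs <;> intro <;> linarith
    · have := gap3 u v h; have := hb2 u; intro; linarith
  have hbhalf : ∀ u v, dd (x u) (x v) = 1 / 2 → (x u < 1 / 2 ↔ ¬ x v < 1 / 2) := by
    intro u v h
    obtain ⟨h1, h2⟩ := hx u; obtain ⟨h3, h4⟩ := hx v
    unfold dd at h
    split_ifs at h <;> constructor <;> intros <;> linarith
  have hbt : ∀ u v, u ≠ v → (dd (x u) (x v) < b u ↔ ¬ dd (x v) (x u) < b v) := by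
    intro u v huv
    have hs := hsum u v huv
    have h1 := hb1 u; have h2 := hb2 u; have h3 := hb1 v; have h4 := hb2 v
    rcases lt_trichotomy (dd (x u) (x v)) (1/2) with h | h | h
    · have := gap2 u v h; have := gap3 v u (by linarith)
      constructor <;> intros <;> linarith
    · have h' : dd (x v) (x u) = 1 / 2 := by linarith
      rw [h, h']
      have hh := hbhalf u v h
      by_cases hu : x u < 1 / 2
      · have hv := hh.1 hu
        simp only [b, if_pos hu, if_neg hv]; constructor <;> intros <;> linarith
      · have hv : x v < 1 / 2 := by by_contra hv; exact hu (hh.2 hv)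
        simp only [b, if_neg hu, if_pos hv]; constructor <;> intros <;> linarith
    · have := gap3 u v h; have := gap2 v u (by linarith)
      constructor <;> intros <;> linarith
  have hblip : ∀ u v, u ≠ v → b u < dd (x u) (x v) + b v := by
    intro u v huv
    linarith [gap0 u v huv, hb2 u, hb1 v]
  have hlt' : ∀ u a, a < min (l u) (max ((1 - e) * k u) (b u)) ↔ a < l u ∧ (a < (1 - e) * k u ∨ a < b u) := by
    intro u a; rw [lt_min_iff, lt_max_iff]
  refine ⟨fun u => min (l u) (max ((1 - e) * k u) (b u)), ?_, ?_, ?_, ?_, ?_, ?_⟩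
  · intro u
    show 0 < min (l u) (max ((1 - e) * k u) (b u))
    rw [hlt']
    exact ⟨hl u, Or.inr (by linarith [hb1 u])⟩
  · intro u
    exact (min_le_left _ _).trans_lt (hl1 u)
  · intro u v h
    simp only at h
    rcases min_choice (l u) (max ((1 - e) * k u) (b u)) with h1 | h1
    · exact hne u v (h1.symm.trans h)
    · rw [h1] at h
      rcases max_choice ((1 - e) * k u) (b u) with h2 | h2
      · rw [h2] at h
        have : dd (x u) (x v) < k u := by nlinarith [hk0 u]
        have := kgap u v this
        linarith
      · exact hbne u v (h2.symm.trans h)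
  · intro u v huv
    simp only
    have h1 := hp u v huv
    have h2 := klip u v huv
    have h3 := hblip u v huv
    have h4 := hpos u v huv
    have h5 : (1 - e) * k u < dd (x u) (x v) + (1 - e) * k v := by nlinarith
    have h6 : max ((1 - e) * k u) (b u) < dd (x u) (x v) + max ((1 - e) * k v) (b v) := by
      apply max_lt
      · linarith [le_max_left ((1 - e) * k v) (b v)]
      · linarith [le_max_right ((1 - e) * k v) (b v)]
    rw [← sub_lt_iff_lt_add', lt_min_iff]
    constructor
    · linarith [min_le_left (l u) (max ((1 - e) * k u) (b u))]
    · linarith [min_le_right (l u) (max ((1 - e) * k u) (b u))]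
  · rintro u v huv ⟨h1, h2⟩
    rw [hlt'] at h1 h2
    have a1 := hkm u v huv.symm h2.1
    have a2 := hkm v u huv h1.1
    have c1 : dd (x u) (x v) < b u := h1.2.resolve_left (by nlinarith [hk0 u])
    have c2 : dd (x v) (x u) < b v := h2.2.resolve_left (by nlinarith [hk0 v])
    exact (hbt u v huv).1 c1 c2
  · have key : ∀ u v, u ≠ v → dd (x u) (x v) < l u →
        (dd (x u) (x v) < min (l u) (max ((1 - e) * k u) (b u)) ∨
          dd (x v) (x u) < min (l v) (max ((1 - e) * k v) (b v))) := by
      intro u v huv h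
      rw [hlt', hlt']
      by_contra hcon
      push Not at hcon
      obtain ⟨c1, c2⟩ := hcon
      obtain ⟨c3, c4⟩ := c1 h
      have c5 : k u ≤ dd (x u) (x v) := by
        by_contra hh; exact absurd (kgap u v (not_le.mp hh)) (not_lt.mpr c3)
      have c6 : dd (x v) (x u) < b v := by
        by_contra hh; exact absurd ((hbt u v huv).2 hh) (not_lt.mpr c4)
      have c7 : dd (x v) (x u) < l v := by
        rcases hk1 u with h1 | ⟨w, hw, hw1, hw2⟩
        · linarith [hlt u v]
        · by_cases hwv : w = v
          · rw [← hwv]; exact hw1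
          · have p1 := hp w v hwv
            have p2 := hsum u w hw.symm
            have p3 := hsum u v huv
            rcases htri u w v with ⟨q1, q2⟩ | ⟨q1, q2⟩ <;> linarith
      linarith [(c2 c7).2]
    intro u v huv
    constructor
    · rintro (h | h)
      · exact key u v huv h
      · exact (key v u huv.symm h).symm
    · rintro (h | h)
      · exact Or.inl ((hlt' _ _).1 h).1
      · exact Or.inr ((hlt' _ _).1 h).1

theorem mem_pts {x y z : ℝ} (hx : x ∈ Set.Ico (0:ℝ) 1) (hy : y ∈ Set.Ico (0:ℝ) 1)
    (hz : z ∈ Set.Ico (0:ℝ) 1) :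
    (y : Circ) ∈ (Arc.mk (x : Circ) (z : Circ)).pts ↔ 0 < dd x y ∧ dd x y < dd x z := by
  show sbtw (x : Circ) (y : Circ) (z : Circ) ↔ _
  rw [sbtw_iff_not_btw]
  have h : btw (z : Circ) (y : Circ) (x : Circ) ↔
      toIcoMod (one_pos : (0:ℝ) < 1) z y ≤ toIocMod (one_pos : (0:ℝ) < 1) z x :=
    QuotientAddGroup.btw_coe_iff
  rw [h]
  obtain ⟨h1, h2⟩ := hx; obtain ⟨h3, h4⟩ := hy; obtain ⟨h5, h6⟩ := hz
  have e1 : toIcoMod (one_pos : (0:ℝ) < 1) z y = if z ≤ y then y else y + 1 := by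
    rw [toIcoMod_eq_iff]
    split_ifs with hh
    · exact ⟨⟨hh, by linarith⟩, 0, by simp⟩
    · exact ⟨⟨by linarith, by linarith⟩, -1, by simp⟩
  have e2 : toIocMod (one_pos : (0:ℝ) < 1) z x = if z < x then x else x + 1 := by
    rw [toIocMod_eq_iff]
    split_ifs with hh
    · exact ⟨⟨hh, by linarith⟩, 0, by simp⟩
    · exact ⟨⟨by linarith, by linarith⟩, -1, by simp⟩
  rw [e1, e2]
  unfold dd
  rw [not_le]
  split_ifs <;> constructor <;> intro hh <;> (try constructor) <;> grind

theorem exists_rep (p : Circ) : ∃ y ∈ Set.Ico (0:ℝ) 1, (y : Circ) = p := by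
  refine ⟨AddCircle.equivIco (1:ℝ) 0 p, ?_, AddCircle.coe_equivIco⟩
  have := (AddCircle.equivIco (1:ℝ) 0 p).2
  simpa using this

theorem coe_inj_Ico {x y : ℝ} (hx : x ∈ Set.Ico (0:ℝ) 1) (hy : y ∈ Set.Ico (0:ℝ) 1)
    (h : (x : Circ) = (y : Circ)) : x = y :=
  (AddCircle.coe_eq_coe_iff_of_mem_Ico (p := (1:ℝ)) (a := 0) (by simpa using hx)
    (by simpa using hy)).1 h

theorem inter_iff {x z x' z' : ℝ} (hx : x ∈ Set.Ico (0:ℝ) 1) (hz : z ∈ Set.Ico (0:ℝ) 1)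
    (hx' : x' ∈ Set.Ico (0:ℝ) 1) (hz' : z' ∈ Set.Ico (0:ℝ) 1) (hne : x ≠ x')
    (h0 : 0 < dd x z) (h0' : 0 < dd x' z') :
    ((Arc.mk (x : Circ) (z : Circ)).pts ∩ (Arc.mk (x' : Circ) (z' : Circ)).pts).Nonempty ↔
      (dd x x' < dd x z ∨ dd x' x < dd x' z') := by
  have back : ∀ {x z x' z' : ℝ}, x ∈ Set.Ico (0:ℝ) 1 → z ∈ Set.Ico (0:ℝ) 1 →
      x' ∈ Set.Ico (0:ℝ) 1 → z' ∈ Set.Ico (0:ℝ) 1 → x ≠ x' → 0 < dd x' z' → dd x x' < dd x z →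
      ∃ p, p ∈ (Arc.mk (x : Circ) (z : Circ)).pts ∧ p ∈ (Arc.mk (x' : Circ) (z' : Circ)).pts := by
    intro x z x' z' hx hz hx' hz' hne h0' h
    obtain ⟨a, ha, ha'⟩ : ∃ a, 0 < a ∧ a < min (dd x z - dd x x') (dd x' z') :=
      exists_between (lt_min (by linarith) h0')
    rw [lt_min_iff] at ha'
    obtain ⟨p, hp, hpa⟩ := exists_dd hx' (a := a) ⟨ha.le, by linarith [dd_lt_one hx' hz']⟩
    have hpos := dd_pos hx hx' hne
    refine ⟨p, (mem_pts hx hp hz).2 ?_, (mem_pts hx' hp hz').2 ⟨by linarith, by linarith⟩⟩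
    rcases dd_tri p hx hx' hp with ⟨q1, q2⟩ | ⟨q1, q2⟩
    · constructor <;> linarith
    · linarith [dd_lt_one hx hz, dd_nonneg hx hp]
  constructor
  · rintro ⟨p, hp1, hp2⟩
    obtain ⟨y, hy, rfl⟩ := exists_rep p
    rw [mem_pts hx hy hz] at hp1
    rw [mem_pts hx' hy hz'] at hp2
    have hs := dd_add hne
    rcases dd_tri y hx hx' hy with ⟨q1, q2⟩ | ⟨q1, q2⟩
    · left; linarith
    · right; linarith
  · rintro (h | h)
    · exact back hx hz hx' hz' hne h0' h
    · obtain ⟨p, h1, h2⟩ := back hx' hz' hx hz hne.symm h0 h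
      exact ⟨p, h2, h1⟩

theorem ssubset_of_le {x z x' z' : ℝ} (hx : x ∈ Set.Ico (0:ℝ) 1) (hz : z ∈ Set.Ico (0:ℝ) 1)
    (hx' : x' ∈ Set.Ico (0:ℝ) 1) (hz' : z' ∈ Set.Ico (0:ℝ) 1) (hne : x ≠ x')
    (h0' : 0 < dd x' z') (h : dd x x' + dd x' z' ≤ dd x z) :
    (Arc.mk (x' : Circ) (z' : Circ)).pts ⊂ (Arc.mk (x : Circ) (z : Circ)).pts := by
  have hpos := dd_pos hx hx' hne
  rw [Set.ssubset_iff_of_subset]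
  · refine ⟨(x' : Circ), (mem_pts hx hx' hz).2 ⟨hpos, by linarith⟩, ?_⟩
    rw [mem_pts hx' hx' hz', dd_self]
    simp
  · intro p hp
    obtain ⟨y, hy, rfl⟩ := exists_rep p
    rw [mem_pts hx' hy hz'] at hp
    rw [mem_pts hx hy hz]
    rcases dd_tri y hx hx' hy with ⟨q1, q2⟩ | ⟨q1, q2⟩
    · constructor <;> linarith
    · linarith [dd_lt_one hx hz, dd_nonneg hx hy]

theorem not_subset_of_lt {x z x' z' : ℝ} (hx : x ∈ Set.Ico (0:ℝ) 1) (hz : z ∈ Set.Ico (0:ℝ) 1)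
    (hx' : x' ∈ Set.Ico (0:ℝ) 1) (hz' : z' ∈ Set.Ico (0:ℝ) 1)
    (h0' : 0 < dd x' z') (h : dd x z < dd x x' + dd x' z') :
    ¬ (Arc.mk (x' : Circ) (z' : Circ)).pts ⊆ (Arc.mk (x : Circ) (z : Circ)).pts := by
  intro hsub
  by_cases hc : dd x x' < dd x z
  · have hzz : (z : Circ) ∈ (Arc.mk (x' : Circ) (z' : Circ)).pts := by
      rw [mem_pts hx' hz hz']
      rcases dd_tri z hx hx' hz with ⟨q1, q2⟩ | ⟨q1, q2⟩
      · constructor <;> linarith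
      · linarith
    have := hsub hzz
    rw [mem_pts hx hz hz] at this
    linarith [this.2]
  · obtain ⟨a, ha, ha'⟩ : ∃ a, 0 < a ∧ a < min (1 - dd x x') (dd x' z') :=
      exists_between (lt_min (by linarith [dd_lt_one hx hx']) h0')
    rw [lt_min_iff] at ha'
    obtain ⟨p, hp, hpa⟩ := exists_dd hx' (a := a) ⟨ha.le, by linarith [dd_lt_one hx' hz']⟩
    have := hsub ((mem_pts hx' hp hz').2 ⟨by linarith, by linarith⟩)
    rw [mem_pts hx hp hz] at this
    rcases dd_tri p hx hx' hp with ⟨q1, q2⟩ | ⟨q1, q2⟩ <;> linarith [this.2, this.1]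

theorem main_model {V : Type} [Fintype V] (M : CAModel V) (hM : M.Proper) :
    ∃ M' : CAModel V, M'.Normal ∧ M'.Proper ∧ ∀ u v, u ≠ v → (M.Inter u v ↔ M'.Inter u v) := by
  choose x hx hxs using fun u => exists_rep (M.arc u).s
  choose z hz hzt using fun u => exists_rep (M.arc u).t
  have harc : ∀ u, M.arc u = ⟨(x u : Circ), (z u : Circ)⟩ := by
    intro u; rw [hxs, hzt]
  have hed := M.endpoints_distinct
  have hinj : Function.Injective x := by
    intro u v h
    have := @hed (u, true) (v, true) (by simp [harc, h])
    exact (Prod.mk.inj this).1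
  have hxz : ∀ u v, x u ≠ z v := by
    intro u v h
    have := @hed (u, true) (v, false) (by simp [harc, h])
    exact absurd (Prod.mk.inj this).2 (by simp)
  have hl0 : ∀ u, 0 < dd (x u) (z u) := fun u => dd_pos (hx u) (hz u) (hxz u u)
  obtain ⟨l', h0, h1, hne, hp, hn, ha⟩ := core x (fun u => dd (x u) (z u)) hx hinj hl0
    (fun u => dd_lt_one (hx u) (hz u))
    (fun u v h => hxz v u (dd_inj (hx u) (hz u) (hx v) h).symm)
    (by
      intro u v huv
      by_contra hcon
      have := ssubset_of_le (hx u) (hz u) (hx v) (hz v) (fun e => huv (hinj e)) (hl0 v)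
        (not_lt.mp hcon)
      rw [← harc, ← harc] at this
      exact hM v u huv.symm this)
  choose w hw hwl using fun u => exists_dd (hx u) (a := l' u) ⟨(h0 u).le, h1 u⟩
  have hxw : ∀ u v, x u ≠ w v := by
    intro u v h
    apply hne v u
    rw [← hwl, h]
  have hwinj : Function.Injective w := by
    intro u v h
    by_contra huv
    have p1 := hp u v huv
    have p2 := hp v u (Ne.symm huv)
    have p3 := dd_add (fun e => huv (hinj e))
    have p4 := hwl u
    have p5 := hwl v
    rw [← h] at p5
    rcases dd_tri (w u) (hx u) (hx v) (hw u) with ⟨q1, q2⟩ | ⟨q1, q2⟩ <;> linarith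
  let M' : CAModel V :=
    { arc := fun u => ⟨(x u : Circ), (w u : Circ)⟩
      endpoints_distinct := by
        rintro ⟨u, a⟩ ⟨v, b⟩ h
        cases a <;> cases b <;> simp only [if_true, Bool.false_eq_true, if_false] at h
        · rw [hwinj (coe_inj_Ico (hw u) (hw v) h)]
        · exact absurd (coe_inj_Ico (hw u) (hx v) h).symm (hxw _ _)
        · exact absurd (coe_inj_Ico (hx u) (hw v) h) (hxw _ _)
        · rw [hinj (coe_inj_Ico (hx u) (hx v) h)] }
  have hl0' : ∀ u, 0 < dd (x u) (w u) := fun u => by rw [hwl]; exact h0 u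
  refine ⟨M', ?_, ?_, ?_⟩
  · intro u v huv hcov
    apply hn u v huv
    rw [← hwl, ← hwl]
    constructor
    · have : (x v : Circ) ∈ (M'.arc u).pts ∪ (M'.arc v).pts := by rw [hcov]; trivial
      rcases this with h | h
      · exact ((mem_pts (hx u) (hx v) (hw u)).1 h).2
      · have := ((mem_pts (hx v) (hx v) (hw v)).1 h).1
        rw [dd_self] at this; exact absurd this (lt_irrefl _)
    · have : (x u : Circ) ∈ (M'.arc u).pts ∪ (M'.arc v).pts := by rw [hcov]; trivial
      rcases this with h | h
      · have := ((mem_pts (hx u) (hx u) (hw u)).1 h).1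
        rw [dd_self] at this; exact absurd this (lt_irrefl _)
      · exact ((mem_pts (hx v) (hx u) (hw v)).1 h).2
  · intro v u huv hss
    refine not_subset_of_lt (hx u) (hw u) (hx v) (hw v) (hl0' v) ?_ hss.subset
    rw [hwl, hwl]
    exact hp u v huv.symm
  · intro u v huv
    have hxuv : x u ≠ x v := fun e => huv (hinj e)
    have i1 := inter_iff (hx u) (hz u) (hx v) (hz v) hxuv (hl0 u) (hl0 v)
    have i2 := inter_iff (hx u) (hw u) (hx v) (hw v) hxuv (hl0' u) (hl0' v)
    rw [← harc, ← harc] at i1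
    rw [hwl, hwl] at i2
    exact i1.trans ((ha u v huv).trans i2.symm)

/-- Every PCA model is equivalent to an NPCA model (same intersection
graph up to isomorphism); consequently, every graph admitting a PCA model admits an
NPCA model. -/
theorem stmt_1 {V : Type} [Fintype V] :
    (∀ M : CAModel V, M.Proper →
      ∃ M' : CAModel V, M'.Normal ∧ M'.Proper ∧
        Nonempty (M.interGraph ≃g M'.interGraph)) ∧
    (∀ G : SimpleGraph V, IsPCAGraph G → IsNPCAGraph G) := by
  constructor
  · intro M hM
    obtain ⟨M', h1, h2, h3⟩ := main_model M hM
    have : M.interGraph = M'.interGraph := by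
      ext u v
      simp only [CAModel.interGraph, SimpleGraph.fromRel_adj]
      constructor
      · rintro ⟨h, h'⟩
        exact ⟨h, h'.imp (h3 u v h).1 (h3 v u h.symm).1⟩
      · rintro ⟨h, h'⟩
        exact ⟨h, h'.imp (h3 u v h).2 (h3 v u h.symm).2⟩
    exact ⟨M', h1, h2, ⟨this ▸ SimpleGraph.Iso.refl⟩⟩
  · rintro G ⟨M, hM, hG⟩
    obtain ⟨M', h1, h2, h3⟩ := main_model M hM
    refine ⟨M', h1, h2, fun u v => ?_⟩
    rw [hG u v]
    exact and_congr_right (fun h => h3 u v h)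
end
end

section
/- For each X among 'normal', 'proper', and 'unit': a graph admits a circular-arc model that is both X and Helly if and only if it admits an X circular-arc model in which no two arcs together cover the whole circle and no three arcs together cover the whole circle. -/
open Set

noncomputable section

/-- coordinate of a point in `[0,1)` -/
def rr (x : Circ) : ℝ := ((AddCircle.equivIco (1:ℝ) 0) x : ℝ)

lemma rr_nonneg (x : Circ) : 0 ≤ rr x := ((AddCircle.equivIco (1:ℝ) 0) x).2.1

lemma rr_lt_one (x : Circ) : rr x < 1 := by
  have := ((AddCircle.equivIco (1:ℝ) 0) x).2.2
  simpa [rr] using this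

lemma coe_rr (x : Circ) : ((rr x : ℝ) : Circ) = x :=
  (AddCircle.equivIco (1:ℝ) 0).symm_apply_apply x

lemma rr_coe {y : ℝ} (h0 : 0 ≤ y) (h1 : y < 1) : rr (y : Circ) = y := by
  unfold rr
  have : y ∈ Set.Ico (0:ℝ) (0+1) := ⟨h0, by simpa using h1⟩
  exact congrArg Subtype.val ((AddCircle.equivIco (1:ℝ) 0).apply_symm_apply ⟨y, this⟩)

lemma rr_inj {x y : Circ} (h : rr x = rr y) : x = y := by
  rw [← coe_rr x, ← coe_rr y, h]

lemma rr_sub_inj {x y q : Circ} (h : rr (x - q) = rr (y - q)) : x = y := by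
  have := rr_inj h
  simpa using this

lemma rr_self (q : Circ) : rr (q - q) = 0 := by
  rw [sub_self]
  have := rr_coe (y := 0) le_rfl one_pos
  simpa using this

lemma rr_pt (q : Circ) {y : ℝ} (h0 : 0 ≤ y) (h1 : y < 1) : rr ((q + (y : Circ)) - q) = y := by
  rw [add_sub_cancel_left, rr_coe h0 h1]

lemma toIco_aux (Q c b : ℝ) (hc : 0 ≤ c) (hc1 : c < 1) (hb : 0 ≤ b) (hb1 : b < 1) :
    toIcoMod (one_pos : (0:ℝ) < 1) (Q + c) (Q + b) = if c ≤ b then Q + b else Q + b + 1 := by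
  rw [toIcoMod_eq_iff]
  split_ifs with h
  · refine ⟨⟨by linarith, by linarith⟩, 0, by simp⟩
  · push Not at h
    refine ⟨⟨by linarith, by linarith⟩, -1, by simp⟩

lemma toIoc_aux (Q c b : ℝ) (hc : 0 ≤ c) (hc1 : c < 1) (hb : 0 ≤ b) (hb1 : b < 1) :
    toIocMod (one_pos : (0:ℝ) < 1) (Q + c) (Q + b) = if c < b then Q + b else Q + b + 1 := by
  rw [toIocMod_eq_iff]
  split_ifs with h
  · refine ⟨⟨by linarith, by linarith⟩, 0, by simp⟩
  · push Not at h
    refine ⟨⟨by linarith, by linarith⟩, -1, by simp⟩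

lemma sbtw_rr (q a x b : Circ) : sbtw a x b ↔
    (rr (a - q) < rr (x - q) ∧ rr (x - q) < rr (b - q)) ∨
    (rr (x - q) < rr (b - q) ∧ rr (b - q) < rr (a - q)) ∨
    (rr (b - q) < rr (a - q) ∧ rr (a - q) < rr (x - q)) := by
  have key : ∀ z : Circ, z = ((rr q + rr (z - q) : ℝ) : Circ) := by
    intro z
    rw [AddCircle.coe_add, coe_rr, coe_rr]; abel
  rw [sbtw_iff_not_btw]
  conv_lhs => rw [key a, key x, key b]
  have h := QuotientAddGroup.btw_coe_iff (hp' := ⟨one_pos⟩) (p := (1:ℝ)) (x₁ := rr q + rr (b - q))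
    (x₂ := rr q + rr (x - q)) (x₃ := rr q + rr (a - q))
  rw [toIco_aux _ _ _ (rr_nonneg _) (rr_lt_one _) (rr_nonneg _) (rr_lt_one _),
    toIoc_aux _ _ _ (rr_nonneg _) (rr_lt_one _) (rr_nonneg _) (rr_lt_one _)] at h
  refine (not_congr h).trans ?_
  have h1 := rr_nonneg (a - q)
  have h2 := rr_nonneg (b - q)
  have h3 := rr_nonneg (x - q)
  have h4 := rr_lt_one (a - q)
  have h5 := rr_lt_one (b - q)
  have h6 := rr_lt_one (x - q)
  generalize rr (a - q) = α at *
  generalize rr (b - q) = β at *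
  generalize rr (x - q) = ξ at *
  clear h
  grind

lemma mem_pts_s2 (q : Circ) (A : Arc) (x : Circ) : x ∈ A.pts ↔
    (rr (A.s - q) < rr (x - q) ∧ rr (x - q) < rr (A.t - q)) ∨
    (rr (x - q) < rr (A.t - q) ∧ rr (A.t - q) < rr (A.s - q)) ∨
    (rr (A.t - q) < rr (A.s - q) ∧ rr (A.s - q) < rr (x - q)) := sbtw_rr q _ _ _

lemma ival (q : Circ) (A : Arc) (hst : A.s ≠ A.t) (hq : q ∉ A.pts) :
    ∃ l h : ℝ, 0 ≤ l ∧ l < h ∧ h ≤ 1 ∧ ∀ x, x ∈ A.pts ↔ l < rr (x - q) ∧ rr (x - q) < h := by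
  have hne : rr (A.s - q) ≠ rr (A.t - q) := fun h => hst (rr_sub_inj h)
  rw [mem_pts_s2 q, rr_self] at hq
  have h1 := rr_nonneg (A.s - q)
  have h2 := rr_nonneg (A.t - q)
  have h3 := rr_lt_one (A.s - q)
  have h4 := rr_lt_one (A.t - q)
  by_cases h0 : rr (A.t - q) = 0
  · refine ⟨rr (A.s - q), 1, h1, h3, le_rfl, fun x => ?_⟩
    rw [mem_pts_s2 q]
    have h5 := rr_nonneg (x - q)
    have h6 := rr_lt_one (x - q)
    grind
  · refine ⟨rr (A.s - q), rr (A.t - q), h1, by grind, h4.le, fun x => ?_⟩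
    rw [mem_pts_s2 q]
    have h5 := rr_nonneg (x - q)
    have h6 := rr_lt_one (x - q)
    grind

lemma three_helly (q : Circ) (A B C : Arc) (hA : A.s ≠ A.t) (hB : B.s ≠ B.t) (hC : C.s ≠ C.t)
    (qA : q ∉ A.pts) (qB : q ∉ B.pts) (qC : q ∉ C.pts)
    (hAB : (A.pts ∩ B.pts).Nonempty) (hAC : (A.pts ∩ C.pts).Nonempty)
    (hBC : (B.pts ∩ C.pts).Nonempty) : ∃ x, x ∈ A.pts ∧ x ∈ B.pts ∧ x ∈ C.pts := by
  obtain ⟨a, a', ha0, haa, ha1, ha⟩ := ival q A hA qA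
  obtain ⟨b, b', hb0, hbb, hb1, hb⟩ := ival q B hB qB
  obtain ⟨c, c', hc0, hcc, hc1, hc⟩ := ival q C hC qC
  obtain ⟨x, hx1, hx2⟩ := hAB
  obtain ⟨y, hy1, hy2⟩ := hAC
  obtain ⟨z, hz1, hz2⟩ := hBC
  rw [ha] at hx1 hy1
  rw [hb] at hx2 hz1
  rw [hc] at hy2 hz2
  have key : max a (max b c) < min a' (min b' c') := by
    simp only [lt_min_iff, max_lt_iff]
    refine ⟨⟨?_, ?_, ?_⟩, ⟨?_, ?_, ?_⟩, ?_, ?_, ?_⟩ <;> linarith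
  obtain ⟨m, hm1, hm2⟩ := exists_between key
  simp only [lt_min_iff, max_lt_iff] at hm1 hm2
  refine ⟨q + (m : Circ), ?_⟩
  rw [ha, hb, hc, rr_pt q (by linarith) (by linarith)]
  exact ⟨⟨hm1.1, hm2.1⟩, ⟨hm1.2.1, hm2.2.1⟩, hm1.2.2, hm2.2.2⟩

lemma inter_ival (A B : Arc) (hA : A.s ≠ A.t) (hB : B.s ≠ B.t)
    (hAB : ∃ y, y ∉ A.pts ∧ y ∉ B.pts) :
    ∃ l h : ℝ, 0 ≤ l ∧ h ≤ 1 ∧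
      ∀ x, x ∈ A.pts ∧ x ∈ B.pts ↔ l < rr (x - A.s) ∧ rr (x - A.s) < h := by
  have qA : A.s ∉ A.pts := by
    rw [mem_pts_s2 A.s, rr_self]
    have := rr_nonneg (A.t - A.s)
    grind
  obtain ⟨a, a', ha0, haa, ha1, ha⟩ := ival A.s A hA qA
  by_cases qB : A.s ∈ B.pts
  · obtain ⟨y, hyA, hyB⟩ := hAB
    refine ⟨0, min (rr (B.t - A.s)) (rr (A.t - A.s)), le_rfl,
      (min_le_left _ _).trans (rr_lt_one _).le, fun x => ?_⟩
    rw [mem_pts_s2 A.s, rr_self] at qB hyA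
    rw [mem_pts_s2 A.s] at hyB
    rw [mem_pts_s2 A.s, mem_pts_s2 A.s, rr_self, lt_min_iff]
    have h1 := rr_nonneg (B.t - A.s)
    have h2 := rr_nonneg (A.t - A.s)
    have h3 := rr_nonneg (x - A.s)
    have h4 := rr_nonneg (y - A.s)
    have h5 := rr_nonneg (B.s - A.s)
    grind
  · obtain ⟨b, b', hb0, hbb, hb1, hb⟩ := ival A.s B hB qB
    refine ⟨max a b, min a' b', le_max_of_le_left ha0, (min_le_left _ _).trans ha1, fun x => ?_⟩
    rw [ha, hb, max_lt_iff, lt_min_iff]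
    tauto

lemma s_notMem (A : Arc) : A.s ∉ A.pts := by
  rw [mem_pts_s2 A.s, rr_self]
  have := rr_nonneg (A.t - A.s)
  grind

lemma t_notMem (A : Arc) : A.t ∉ A.pts := by
  rw [mem_pts_s2 A.s, rr_self]
  have := rr_nonneg (A.t - A.s)
  grind

lemma arc_nonempty (A : Arc) (hA : A.s ≠ A.t) : A.pts.Nonempty := by
  obtain ⟨a, a', ha0, haa, ha1, ha⟩ := ival A.s A hA (s_notMem A)
  obtain ⟨m, hm1, hm2⟩ := exists_between haa
  refine ⟨A.s + (m : Circ), ?_⟩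
  rw [ha, rr_pt _ (by linarith) (by linarith)]
  exact ⟨hm1, hm2⟩

namespace CAModel
variable {V : Type} [Fintype V]

lemma s_ne_t (M : CAModel V) (u v : V) : (M.arc u).s ≠ (M.arc v).t := by
  intro h
  have := @M.endpoints_distinct (u, true) (v, false) (by simpa using h)
  simp at this

lemma s_ne_s (M : CAModel V) {u v : V} (h : u ≠ v) : (M.arc u).s ≠ (M.arc v).s := by
  intro h'
  have := @M.endpoints_distinct (u, true) (v, true) (by simpa using h')
  simp at this
  exact h this

lemma t_ne_t (M : CAModel V) {u v : V} (h : u ≠ v) : (M.arc u).t ≠ (M.arc v).t := by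
  intro h'
  have := @M.endpoints_distinct (u, false) (v, false) (by simpa using h')
  simp at this
  exact h this

lemma inter_self (M : CAModel V) (u : V) : M.Inter u u := by
  unfold Inter
  rw [Set.inter_self]
  exact arc_nonempty _ (M.s_ne_t u u)

lemma inter_symm (M : CAModel V) {u v : V} (h : M.Inter u v) : M.Inter v u := by
  unfold Inter at *
  rwa [Set.inter_comm]

lemma exists_two (M : CAModel V) (hN : M.Normal) (u v : V) :
    ∃ q, q ∉ (M.arc u).pts ∧ q ∉ (M.arc v).pts := by
  by_cases h : u = v
  · subst h; exact ⟨_, s_notMem _, s_notMem _⟩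
  · have := hN u v h
    rw [Set.ne_univ_iff_exists_notMem] at this
    simpa using this

lemma exists_three (M : CAModel V) (hN : M.Normal) (hT : M.NoThreeCover) (u v w : V) :
    ∃ q, q ∉ (M.arc u).pts ∧ q ∉ (M.arc v).pts ∧ q ∉ (M.arc w).pts := by
  by_cases h : u = v
  · obtain ⟨q, h1, h2⟩ := M.exists_two hN u w
    exact ⟨q, h1, h ▸ h1, h2⟩
  by_cases h' : u = w
  · obtain ⟨q, h1, h2⟩ := M.exists_two hN u v
    exact ⟨q, h1, h2, h' ▸ h1⟩
  by_cases h'' : v = w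
  · obtain ⟨q, h1, h2⟩ := M.exists_two hN u v
    exact ⟨q, h1, h2, h'' ▸ h2⟩
  have := hT u v w h h' h''
  rw [Set.ne_univ_iff_exists_notMem] at this
  simpa [and_assoc] using this

theorem helly_of_noCover (M : CAModel V) (hN : M.Normal) (hT : M.NoThreeCover) : M.Helly := by
  classical
  intro S hS
  by_cases hne : S.Nonempty
  swap
  · refine ⟨0, fun v hv => (hne ⟨v, hv⟩).elim⟩
  obtain ⟨a, haS⟩ := hne
  have H := fun v => inter_ival (M.arc a) (M.arc v) (M.s_ne_t a a) (M.s_ne_t v v)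
    (M.exists_two hN a v)
  choose l h hl hh hlh using H
  have hlt : ∀ u ∈ S, ∀ v ∈ S, l u < h v := by
    intro u hu v hv
    obtain ⟨q, q1, q2, q3⟩ := M.exists_three hN hT a u v
    obtain ⟨x, x1, x2, x3⟩ := three_helly q _ _ _ (M.s_ne_t a a) (M.s_ne_t u u) (M.s_ne_t v v)
      q1 q2 q3 (hS a haS u hu) (hS a haS v hv) (hS u hu v hv)
    exact ((hlh u x).1 ⟨x1, x2⟩).1.trans ((hlh v x).1 ⟨x1, x3⟩).2
  obtain ⟨u, hu, hmax⟩ := S.toFinset.exists_max_image l ⟨a, by simpa using haS⟩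
  obtain ⟨v, hv, hmin⟩ := S.toFinset.exists_min_image h ⟨a, by simpa using haS⟩
  simp only [Set.mem_toFinset] at hu hv hmax hmin
  obtain ⟨m, hm1, hm2⟩ := exists_between (hlt u hu v hv)
  refine ⟨(M.arc a).s + (m : Circ), fun w hw => ?_⟩
  refine ((hlh w _).2 ?_).2
  rw [rr_pt _ (by linarith [hl u]) (by linarith [hh v])]
  exact ⟨(hmax w hw).trans_lt hm1, hm2.trans_le (hmin w hw)⟩

lemma inter_of_cover (M : CAModel V) (hN : M.Normal) (u v w : V)
    (huv : u ≠ v) (huw : u ≠ w) (hvw : v ≠ w)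
    (hc : ∀ x, x ∈ (M.arc u).pts ∨ x ∈ (M.arc v).pts ∨ x ∈ (M.arc w).pts) : M.Inter u v := by
  by_contra hno
  have hdis : ∀ x, x ∈ (M.arc u).pts → x ∈ (M.arc v).pts → False :=
    fun x h1 h2 => hno ⟨x, h1, h2⟩
  obtain ⟨q, q1, q2⟩ := M.exists_two hN u w
  obtain ⟨a, a', ha0, haa, ha1, ha⟩ := ival q _ (M.s_ne_t u u) q1
  obtain ⟨c, c', hc0, hcc, hc1, hcm⟩ := ival q _ (M.s_ne_t w w) q2
  have hq : q ∈ (M.arc v).pts := by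
    rcases hc q with h | h | h
    · exact (q1 h).elim
    · exact h
    · exact (q2 h).elim
  rw [mem_pts_s2 q, rr_self] at hq
  have hs0 := rr_nonneg ((M.arc v).s - q)
  have ht0 := rr_nonneg ((M.arc v).t - q)
  have hs1 := rr_lt_one ((M.arc v).s - q)
  have ht1 := rr_lt_one ((M.arc v).t - q)
  have hv : 0 < rr ((M.arc v).t - q) ∧ rr ((M.arc v).t - q) < rr ((M.arc v).s - q) := by grind
  -- `u` lies in the gap of `v`
  have e1 : rr ((M.arc v).t - q) ≤ a := by
    by_contra hlt
    push Not at hlt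
    obtain ⟨m, hm1, hm2⟩ := exists_between (lt_min hlt haa)
    have hm3 := lt_min_iff.1 hm2
    refine hdis (q + (m : Circ)) ?_ ?_
    · rw [ha, rr_pt _ (by linarith) (by linarith)]; exact ⟨hm1, hm3.2⟩
    · rw [mem_pts_s2 q, rr_pt _ (by linarith) (by linarith)]; exact Or.inr (Or.inl ⟨hm3.1, hv.2⟩)
  have e2 : a' ≤ rr ((M.arc v).s - q) := by
    by_contra hlt
    push Not at hlt
    obtain ⟨m, hm1, hm2⟩ := exists_between (max_lt hlt haa)
    have hm3 := max_lt_iff.1 hm1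
    refine hdis (q + (m : Circ)) ?_ ?_
    · rw [ha, rr_pt _ (by linarith) (by linarith)]; exact ⟨hm3.2, hm2⟩
    · rw [mem_pts_s2 q, rr_pt _ (by linarith) (by linarith)]; exact Or.inr (Or.inr ⟨hv.2, hm3.1⟩)
  have f1 : (M.arc v).t ∈ (M.arc w).pts := by
    rcases hc (M.arc v).t with h | h | h
    · rw [ha] at h; linarith
    · exact (t_notMem _ h).elim
    · exact h
  have f2 : (M.arc v).s ∈ (M.arc w).pts := by
    rcases hc (M.arc v).s with h | h | h
    · rw [ha] at h; linarith
    · exact (s_notMem _ h).elim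
    · exact h
  rw [hcm] at f1 f2
  obtain ⟨x, x1, x2⟩ := M.exists_two hN v w
  rw [hcm] at x2
  rw [mem_pts_s2 q] at x1
  have := rr_nonneg (x - q)
  grind

theorem noThree_of_helly (M : CAModel V) (hN : M.Normal) (hH : M.Helly) : M.NoThreeCover := by
  intro u v w huv huw hvw hcov
  have hc : ∀ x, x ∈ (M.arc u).pts ∨ x ∈ (M.arc v).pts ∨ x ∈ (M.arc w).pts := by
    intro x
    have : x ∈ (M.arc u).pts ∪ (M.arc v).pts ∪ (M.arc w).pts := hcov ▸ Set.mem_univ x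
    simpa [or_assoc] using this
  have i1 := M.inter_of_cover hN u v w huv huw hvw hc
  have i2 := M.inter_of_cover hN u w v huw huv hvw.symm (fun x => by have := hc x; tauto)
  have i3 := M.inter_of_cover hN v w u hvw huv.symm huw.symm (fun x => by have := hc x; tauto)
  obtain ⟨q, hq⟩ := hH {u, v, w} (by
    intro x hx y hy
    simp only [Set.mem_insert_iff, Set.mem_singleton_iff] at hx hy
    rcases hx with rfl | rfl | rfl <;> rcases hy with rfl | rfl | rfl <;>
      first | exact M.inter_self _ | assumption | (apply inter_symm; assumption))
  have form : ∀ z, q ∈ (M.arc z).pts → rr ((M.arc z).t - q) < rr ((M.arc z).s - q) ∧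
      ∀ x, x ∈ (M.arc z).pts ↔ rr (x - q) < rr ((M.arc z).t - q) ∨
        rr ((M.arc z).s - q) < rr (x - q) := by
    intro z hz
    rw [mem_pts_s2 q, rr_self] at hz
    have hs0 := rr_nonneg ((M.arc z).s - q)
    have ht0 := rr_nonneg ((M.arc z).t - q)
    refine ⟨by grind, fun x => ?_⟩
    rw [mem_pts_s2 q]
    grind
  obtain ⟨u1, u2⟩ := form u (hq u (by simp))
  obtain ⟨v1, v2⟩ := form v (hq v (by simp))
  obtain ⟨w1, w2⟩ := form w (hq w (by simp))
  obtain ⟨x, x1, x2⟩ := M.exists_two hN u v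
  obtain ⟨y, y1, y2⟩ := M.exists_two hN u w
  obtain ⟨z, z1, z2⟩ := M.exists_two hN v w
  have c1 := hc (M.arc u).t
  have c2 := hc (M.arc v).t
  have c3 := hc (M.arc w).t
  simp only [u2, v2, w2] at x1 x2 y1 y2 z1 z2 c1 c2 c3
  grind

end CAModel
namespace CAModel
variable {V : Type} [Fintype V]

lemma not_subset_of_proper (M : CAModel V) (hP : M.Proper) {u v : V} (huv : u ≠ v) :
    ¬ (M.arc u).pts ⊆ (M.arc v).pts := by
  intro hsub
  have heq : (M.arc v).pts ⊆ (M.arc u).pts := by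
    by_contra h
    exact hP u v huv ⟨hsub, h⟩
  have k0 : ∀ x, x ∈ (M.arc u).pts ↔ x ∈ (M.arc v).pts := fun x => ⟨@hsub x, @heq x⟩
  have n1 : rr ((M.arc u).t - (M.arc v).s) ≠ 0 := by
    rw [← rr_self (M.arc v).s]
    exact fun h => M.s_ne_t v u (rr_sub_inj h).symm
  have n2 : rr ((M.arc u).s - (M.arc v).s) ≠ 0 := by
    rw [← rr_self (M.arc v).s]
    exact fun h => M.s_ne_s huv (rr_sub_inj h)
  have n3 : rr ((M.arc u).t - (M.arc v).s) ≠ rr ((M.arc v).t - (M.arc v).s) :=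
    fun h => M.t_ne_t huv (rr_sub_inj h)
  have k1 := (k0 (M.arc v).s).1.mt (s_notMem _)
  have k2 := (k0 (M.arc u).s).2.mt (s_notMem _)
  have k3 := (k0 (M.arc u).t).2.mt (t_notMem _)
  obtain ⟨x, hx⟩ := arc_nonempty _ (M.s_ne_t u u)
  have hx' := hsub hx
  rw [mem_pts_s2 (M.arc v).s] at k1 k2 k3 hx hx'
  rw [rr_self] at k1 k2 k3 hx'
  have h1 := rr_nonneg ((M.arc u).s - (M.arc v).s)
  have h2 := rr_nonneg ((M.arc u).t - (M.arc v).s)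
  have h3 := rr_nonneg (x - (M.arc v).s)
  grind

lemma rr_sub_cyc (q a b : Circ) : rr (b - a) =
    if rr (a - q) ≤ rr (b - q) then rr (b - q) - rr (a - q) else rr (b - q) - rr (a - q) + 1 := by
  have e : b - a = ((rr (b - q) - rr (a - q) : ℝ) : Circ) := by
    rw [AddCircle.coe_sub, coe_rr, coe_rr]; abel
  have e' : b - a = ((rr (b - q) - rr (a - q) + 1 : ℝ) : Circ) := by
    rw [AddCircle.coe_add, ← e, AddCircle.coe_period, add_zero]
  have h1 := rr_nonneg (a - q)
  have h2 := rr_nonneg (b - q)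
  have h3 := rr_lt_one (a - q)
  have h4 := rr_lt_one (b - q)
  split_ifs with h
  · conv_lhs => rw [e]
    exact rr_coe (by linarith) (by linarith)
  · push Not at h
    conv_lhs => rw [e']
    exact rr_coe (by linarith) (by linarith)

lemma proper_of_unit (M : CAModel V) (hU : M.IsUnit) : M.Proper := by
  intro u v huv hss
  have hsub := hss.1
  have hlen : (M.arc u).t - (M.arc u).s = (M.arc v).t - (M.arc v).s :=
    (AddCircle.equivIoc (1:ℝ) 0).injective (Subtype.ext (hU u v))
  have hlen' := rr_sub_cyc (M.arc v).s (M.arc u).s (M.arc u).t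
  rw [hlen] at hlen'
  have n1 : rr ((M.arc u).t - (M.arc v).s) ≠ 0 := by
    rw [← rr_self (M.arc v).s]
    exact fun h => M.s_ne_t v u (rr_sub_inj h).symm
  have n2 : rr ((M.arc u).s - (M.arc v).s) ≠ 0 := by
    rw [← rr_self (M.arc v).s]
    exact fun h => M.s_ne_s huv (rr_sub_inj h)
  have n3 : rr ((M.arc u).t - (M.arc v).s) ≠ rr ((M.arc u).s - (M.arc v).s) :=
    fun h => M.s_ne_t u u (rr_sub_inj h).symm
  have k1 := (@hsub (M.arc v).s).mt (s_notMem _)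
  rw [mem_pts_s2 (M.arc v).s, rr_self] at k1
  have h1 := rr_nonneg ((M.arc u).s - (M.arc v).s)
  have h2 := rr_nonneg ((M.arc u).t - (M.arc v).s)
  have h3 := rr_lt_one ((M.arc u).t - (M.arc v).s)
  have lt : rr ((M.arc u).s - (M.arc v).s) < rr ((M.arc u).t - (M.arc v).s) := by grind
  rw [if_pos lt.le] at hlen'
  have lt2 : max (rr ((M.arc u).s - (M.arc v).s)) (rr ((M.arc v).t - (M.arc v).s)) <
      rr ((M.arc u).t - (M.arc v).s) := max_lt lt (by
        have := lt_of_le_of_ne h1 n2.symm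
        linarith)
  obtain ⟨m, hm1, hm2⟩ := exists_between lt2
  have hm3 := max_lt_iff.1 hm1
  have hin : (M.arc v).s + (m : Circ) ∈ (M.arc u).pts := by
    rw [mem_pts_s2 (M.arc v).s, rr_pt _ (by linarith) (by linarith)]
    exact Or.inl ⟨hm3.1, hm2⟩
  have hin' := hsub hin
  rw [mem_pts_s2 (M.arc v).s, rr_pt _ (by linarith) (by linarith), rr_self] at hin'
  have h4 := rr_nonneg ((M.arc v).t - (M.arc v).s)
  grind

/-- If two arcs of a proper Helly model cover the circle, then the graph consists of universal
vertices and two cliques without edges between them. -/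
lemma classify (M : CAModel V) (hP : M.Proper) (hH : M.Helly) (hN : ¬ M.Normal) :
    ∃ f : V → Fin 3, ∀ u v, u ≠ v →
      (M.Inter u v ↔ ¬ ((f u = 0 ∧ f v = 2) ∨ (f u = 2 ∧ f v = 0))) := by
  classical
  unfold Normal at hN
  push Not at hN
  obtain ⟨a, b, hab, hcov⟩ := hN
  have hc : ∀ x, x ∈ (M.arc a).pts ∨ x ∈ (M.arc b).pts := by
    intro x
    have : x ∈ (M.arc a).pts ∪ (M.arc b).pts := hcov ▸ Set.mem_univ x
    simpa using this
  set q := (M.arc a).s with hqdef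
  have as : q ∈ (M.arc b).pts := (hc _).resolve_left (s_notMem _)
  have at' : (M.arc a).t ∈ (M.arc b).pts := (hc _).resolve_left (t_notMem _)
  have bs : (M.arc b).s ∈ (M.arc a).pts := (hc _).resolve_right (s_notMem _)
  have bt : (M.arc b).t ∈ (M.arc a).pts := (hc _).resolve_right (t_notMem _)
  have as' := as
  have at'' := at'
  have bs' := bs
  have bt' := bt
  rw [mem_pts_s2 q] at as' at'' bs' bt'
  rw [← hqdef, rr_self] at bs' bt'
  rw [rr_self] at as'
  have h1 := rr_nonneg ((M.arc a).t - q)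
  have h2 := rr_nonneg ((M.arc b).s - q)
  have h3 := rr_nonneg ((M.arc b).t - q)
  have o1 : 0 < rr ((M.arc b).t - q) := by grind
  have o2 : rr ((M.arc b).t - q) < rr ((M.arc b).s - q) := by grind
  have o3 : rr ((M.arc b).s - q) < rr ((M.arc a).t - q) := by grind
  have memA : ∀ x, x ∈ (M.arc a).pts ↔ 0 < rr (x - q) ∧ rr (x - q) < rr ((M.arc a).t - q) := by
    intro x
    rw [mem_pts_s2 q, ← hqdef, rr_self]
    have := rr_nonneg (x - q)
    grind
  have memB : ∀ x, x ∈ (M.arc b).pts ↔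
      rr (x - q) < rr ((M.arc b).t - q) ∨ rr ((M.arc b).s - q) < rr (x - q) := by
    intro x
    rw [mem_pts_s2 q]
    have := rr_nonneg (x - q)
    grind
  obtain ⟨P, hPdef⟩ : ∃ P : Set Circ, P =
    {x | rr ((M.arc b).s - q) ≤ rr (x - q) ∧ rr (x - q) ≤ rr ((M.arc a).t - q)} := ⟨_, rfl⟩
  obtain ⟨Q, hQdef⟩ : ∃ Q : Set Circ, Q = {x | rr (x - q) ≤ rr ((M.arc b).t - q)} := ⟨_, rfl⟩
  have bsP : (M.arc b).s ∈ P := by rw [hPdef]; exact ⟨le_rfl, o3.le⟩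
  have atP : (M.arc a).t ∈ P := by rw [hPdef]; exact ⟨o3.le, le_rfl⟩
  have btQ : (M.arc b).t ∈ Q := by rw [hQdef]; exact le_refl (rr ((M.arc b).t - q))
  have asQ : q ∈ Q := by
    rw [hQdef]
    change rr (q - q) ≤ _
    rw [rr_self]
    exact o1.le
  have hPQ : ∀ x, x ∈ (M.arc a).pts → x ∈ (M.arc b).pts → x ∈ P ∨ x ∈ Q := by
    intro x hx hx'
    rw [memA] at hx
    rw [memB] at hx'
    rw [hPdef, hQdef]
    simp only [Set.mem_ofPred_eq]
    grind
  have key : ∀ c, c ≠ a → c ≠ b → P ⊆ (M.arc c).pts ∨ Q ⊆ (M.arc c).pts := by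
    intro c hca hcb
    obtain ⟨x, x1, x2⟩ := Set.not_subset.1 (M.not_subset_of_proper hP hca)
    obtain ⟨y, y1, y2⟩ := Set.not_subset.1 (M.not_subset_of_proper hP hcb)
    rw [memA] at x2
    rw [memB] at y2
    rw [mem_pts_s2 q] at x1 y1
    have g1 := rr_nonneg (x - q)
    have g2 := rr_nonneg (y - q)
    have g3 := rr_nonneg ((M.arc c).s - q)
    have g4 := rr_nonneg ((M.arc c).t - q)
    rw [hPdef, hQdef]
    by_cases hh : (rr ((M.arc c).s - q) < rr ((M.arc b).s - q) ∧
        (rr ((M.arc c).t - q) < rr ((M.arc c).s - q) ∨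
          rr ((M.arc a).t - q) < rr ((M.arc c).t - q)))
    · left
      rintro z ⟨z1, z2⟩
      rw [mem_pts_s2 q]
      grind
    · right
      intro z (z1 : rr (z - q) ≤ _)
      rw [mem_pts_s2 q]
      grind
  have uA : ∀ w, M.Inter a w := by
    intro w
    by_cases hwa : w = a
    · subst hwa; exact M.inter_self _
    by_cases hwb : w = b
    · subst hwb
      obtain ⟨x, x1, x2⟩ := Set.not_subset.1 (M.not_subset_of_proper hP hwa)
      by_contra hno
      -- a point of both arcs exists between `B.s` and `A.t`
      obtain ⟨m, hm1, hm2⟩ := exists_between o3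
      refine hno ⟨q + (m : Circ), ?_, ?_⟩
      · rw [memA, rr_pt _ (by linarith) (by linarith [rr_lt_one ((M.arc a).t - q)])]
        exact ⟨by linarith, hm2⟩
      · rw [memB, rr_pt _ (by linarith) (by linarith [rr_lt_one ((M.arc a).t - q)])]
        exact Or.inr hm1
    rcases key w hwa hwb with h | h
    · exact ⟨_, bs, h bsP⟩
    · exact ⟨_, bt, h btQ⟩
  have uB : ∀ w, M.Inter b w := by
    intro w
    by_cases hwa : w = a
    · subst hwa; exact M.inter_symm (uA b)
    by_cases hwb : w = b
    · subst hwb; exact M.inter_self _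
    rcases key w hwa hwb with h | h
    · exact ⟨_, at', h atP⟩
    · exact ⟨_, as, h asQ⟩
  have edge : ∀ c d, P ⊆ (M.arc c).pts → Q ⊆ (M.arc d).pts → M.Inter c d →
      (∀ w, M.Inter c w) ∨ (∀ w, M.Inter d w) := by
    intro c d hcP hdQ hcd
    obtain ⟨x, hx⟩ := hH {a, b, c, d} (by
      intro x hx y hy
      simp only [Set.mem_insert_iff, Set.mem_singleton_iff] at hx hy
      rcases hx with rfl | rfl | rfl | rfl
      · exact uA _
      · exact uB _
      · rcases hy with rfl | rfl | rfl | rfl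
        · exact M.inter_symm (uA _)
        · exact M.inter_symm (uB _)
        · exact M.inter_self _
        · exact hcd
      · rcases hy with rfl | rfl | rfl | rfl
        · exact M.inter_symm (uA _)
        · exact M.inter_symm (uB _)
        · exact M.inter_symm hcd
        · exact M.inter_self _)
    have xa := hx a (by simp)
    have xb := hx b (by simp)
    have xc := hx c (by simp)
    have xd := hx d (by simp)
    rcases hPQ x xa xb with hxP | hxQ
    · right
      intro w
      by_cases hwa : w = a
      · subst hwa; exact M.inter_symm (uA _)
      by_cases hwb : w = b
      · subst hwb; exact M.inter_symm (uB _)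
      rcases key w hwa hwb with h | h
      · exact ⟨x, xd, h hxP⟩
      · exact ⟨q, hdQ asQ, h asQ⟩
    · left
      intro w
      by_cases hwa : w = a
      · subst hwa; exact M.inter_symm (uA _)
      by_cases hwb : w = b
      · subst hwb; exact M.inter_symm (uB _)
      rcases key w hwa hwb with h | h
      · exact ⟨_, hcP bsP, h bsP⟩
      · exact ⟨x, xc, h hxQ⟩
  have key' : ∀ c, ¬ (∀ w, M.Inter c w) → P ⊆ (M.arc c).pts ∨ Q ⊆ (M.arc c).pts := by
    intro c hcu
    refine key c ?_ ?_
    · rintro rfl; exact hcu uA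
    · rintro rfl; exact hcu uB
  refine ⟨fun v => if ∀ w, M.Inter v w then 1 else if P ⊆ (M.arc v).pts then 0 else 2, ?_⟩
  intro u v huv
  by_cases hu : ∀ w, M.Inter u w
  · simp [hu]
  by_cases hv : ∀ w, M.Inter v w
  · simp [hv, M.inter_symm (hv u)]
  by_cases hu' : P ⊆ (M.arc u).pts <;> by_cases hv' : P ⊆ (M.arc v).pts
  · simp only [hu, hv, hu', hv', if_true, if_false]
    simp only [show ((0 : Fin 3) = 2) = False by simp, and_false, false_and, or_false, not_false_eq_true, iff_true]
    exact ⟨_, hu' bsP, hv' bsP⟩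
  · simp only [hu, hv, hu', hv', if_true, if_false]
    simp only [and_self, true_or, not_true_eq_false, iff_false]
    intro hi
    rcases edge u v hu' ((key' v hv).resolve_left hv') hi with h | h
    · exact hu h
    · exact hv h
  · simp only [hu, hv, hu', hv', if_true, if_false]
    simp only [and_self, or_true, not_true_eq_false, iff_false]
    intro hi
    rcases edge v u hv' ((key' u hu).resolve_left hu') (M.inter_symm hi) with h | h
    · exact hv h
    · exact hu h
  · simp only [hu, hv, hu', hv', if_false]
    simp only [show ((2 : Fin 3) = 0) = False by simp, and_false, false_and, or_false, not_false_eq_true, iff_true]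
    exact ⟨_, (key' u hu).resolve_left hu' asQ, (key' v hv).resolve_left hv' asQ⟩

lemma build (f : V → Fin 3) : ∃ M : CAModel V, M.IsUnit ∧ M.Normal ∧ M.NoThreeCover ∧
    ∀ u v, u ≠ v → (M.Inter u v ↔ ¬ ((f u = 0 ∧ f v = 2) ∨ (f u = 2 ∧ f v = 0))) := by
  classical
  obtain ⟨d, dinj, d0, d1⟩ : ∃ d : V → ℝ, Function.Injective d ∧ (∀ v, 0 ≤ d v) ∧
      ∀ v, d v < 1 / 20 := by
    let e := Fintype.equivFin V
    refine ⟨fun v => ((e v : ℕ) : ℝ) / (20 * (Fintype.card V : ℝ)), ?_, fun v => by positivity, ?_⟩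
    · intro u v h
      have hpos : (0:ℝ) < 20 * (Fintype.card V : ℝ) := by
        have : 0 < Fintype.card V := Fintype.card_pos_iff.2 ⟨u⟩
        positivity
      simp only at h
      rw [div_left_inj' hpos.ne'] at h
      exact e.injective (Fin.ext (by exact_mod_cast h))
    · intro v
      have hp : 0 < Fintype.card V := Fintype.card_pos_iff.2 ⟨v⟩
      have hp' : (0:ℝ) < Fintype.card V := by exact_mod_cast hp
      have : ((e v : ℕ) : ℝ) < Fintype.card V := by exact_mod_cast (e v).2
      rw [div_lt_div_iff₀ (by positivity) (by norm_num)]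
      linarith
  obtain ⟨s, hs⟩ : ∃ s : V → ℝ, ∀ v, s v = 1 / 10 + 3 / 20 * ((f v : ℕ) : ℝ) + d v := ⟨_, fun _ => rfl⟩
  have fcase : ∀ v, (f v = 0 ∧ s v = 1 / 10 + d v) ∨ (f v = 1 ∧ s v = 1 / 4 + d v) ∨
      (f v = 2 ∧ s v = 2 / 5 + d v) := by
    intro v
    have := hs v
    have h3 : f v = 0 ∨ f v = 1 ∨ f v = 2 := by
      generalize f v = i
      fin_cases i <;> simp
    rcases h3 with h | h | h
    · left; refine ⟨h, ?_⟩; rw [this, h]; norm_num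
    · right; left; refine ⟨h, ?_⟩; rw [this, h]; norm_num
    · right; right; refine ⟨h, ?_⟩; rw [this, h]; norm_num
  have sb : ∀ v, 1 / 10 ≤ s v ∧ s v < 1 / 2 := by
    intro v
    have := d0 v
    have := d1 v
    rcases fcase v with ⟨_, h⟩ | ⟨_, h⟩ | ⟨_, h⟩ <;> rw [h] <;> constructor <;> linarith
  have rs : ∀ v, rr ((s v : ℝ) : Circ) = s v := fun v =>
    rr_coe (by linarith [sb v]) (by linarith [sb v])
  have rt : ∀ v, rr ((s v + 1 / 5 : ℝ) : Circ) = s v + 1 / 5 := fun v =>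
    rr_coe (by linarith [sb v]) (by linarith [sb v])
  have sinj : ∀ u v, s u = s v → u = v := by
    intro u v h
    apply dinj
    have := d0 u
    have := d1 u
    have := d0 v
    have := d1 v
    rcases fcase u with ⟨_, h1⟩ | ⟨_, h1⟩ | ⟨_, h1⟩ <;>
      rcases fcase v with ⟨_, h2⟩ | ⟨_, h2⟩ | ⟨_, h2⟩ <;> linarith
  have snt : ∀ u v, s u ≠ s v + 1 / 5 := by
    intro u v h
    have := d0 u
    have := d1 u
    have := d0 v
    have := d1 v
    rcases fcase u with ⟨_, h1⟩ | ⟨_, h1⟩ | ⟨_, h1⟩ <;>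
      rcases fcase v with ⟨_, h2⟩ | ⟨_, h2⟩ | ⟨_, h2⟩ <;> linarith
  let M : CAModel V :=
    { arc := fun v => ⟨((s v : ℝ) : Circ), ((s v + 1 / 5 : ℝ) : Circ)⟩
      endpoints_distinct := by
        rintro ⟨u, bu⟩ ⟨v, bv⟩ h
        have h' := congrArg rr h
        cases bu <;> cases bv <;> simp only [if_true, if_false, Bool.false_eq_true, rs, rt] at h'
        · rw [sinj u v (by linarith)]
        · exact (snt v u h'.symm).elim
        · exact (snt u v h').elim
        · rw [sinj u v h'] }
  have mem : ∀ v x, x ∈ (M.arc v).pts ↔ s v < rr x ∧ rr x < s v + 1 / 5 := by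
    intro v x
    rw [mem_pts_s2 0]
    simp only [sub_zero]
    change (rr ((s v : ℝ) : Circ) < _ ∧ _ < rr ((s v + 1 / 5 : ℝ) : Circ)) ∨
      (_ < rr ((s v + 1 / 5 : ℝ) : Circ) ∧ rr ((s v + 1 / 5 : ℝ) : Circ) < rr ((s v : ℝ) : Circ)) ∨
      (rr ((s v + 1 / 5 : ℝ) : Circ) < rr ((s v : ℝ) : Circ) ∧ rr ((s v : ℝ) : Circ) < _) ↔ _
    rw [rs, rt]
    grind
  have rr0 : rr (0 : Circ) = 0 := by simpa using rr_self 0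
  have zero : ∀ v, (0 : Circ) ∉ (M.arc v).pts := by
    intro v h
    rw [mem, rr0] at h
    linarith [sb v]
  refine ⟨M, ?_, ?_, ?_, ?_⟩
  · have hl : ∀ w, (M.arc w).t - (M.arc w).s = ((1 / 5 : ℝ) : Circ) := by
      intro w
      change ((s w + 1 / 5 : ℝ) : Circ) - ((s w : ℝ) : Circ) = _
      rw [AddCircle.coe_add, add_sub_cancel_left]
    intro u v
    unfold Arc.length
    rw [hl, hl]
  · intro u v _ h
    have : (0 : Circ) ∈ (M.arc u).pts ∪ (M.arc v).pts := h ▸ Set.mem_univ _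
    rcases this with h | h
    · exact zero _ h
    · exact zero _ h
  · intro u v w _ _ _ h
    have : (0 : Circ) ∈ (M.arc u).pts ∪ (M.arc v).pts ∪ (M.arc w).pts := h ▸ Set.mem_univ _
    rcases this with (h | h) | h
    · exact zero _ h
    · exact zero _ h
    · exact zero _ h
  · intro u v _
    have hi : M.Inter u v ↔ s u < s v + 1 / 5 ∧ s v < s u + 1 / 5 := by
      constructor
      · rintro ⟨x, x1, x2⟩
        rw [mem] at x1 x2
        constructor <;> linarith
      · rintro ⟨h1, h2⟩
        refine ⟨(((s u + s v + 1 / 5) / 2 : ℝ) : Circ), ?_, ?_⟩ <;>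
        · rw [mem, rr_coe (by linarith [sb u, sb v]) (by linarith [sb u, sb v])]
          constructor <;> linarith
    rw [hi]
    have := d0 u
    have := d1 u
    have := d0 v
    have := d1 v
    rcases fcase u with ⟨g1, h1⟩ | ⟨g1, h1⟩ | ⟨g1, h1⟩ <;>
      rcases fcase v with ⟨g2, h2⟩ | ⟨g2, h2⟩ | ⟨g2, h2⟩ <;> rw [g1, g2, h1, h2] <;> simp <;>
      (try constructor) <;> (try intro) <;> linarith

lemma rebuild (M : CAModel V) (hP : M.Proper) (hH : M.Helly) (hN : ¬ M.Normal)
    (G : SimpleGraph V) (hG : M.IsModelOf G) :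
    ∃ M : CAModel V, M.IsUnit ∧ M.Normal ∧ M.NoThreeCover ∧ M.IsModelOf G := by
  obtain ⟨f, hf⟩ := M.classify hP hH hN
  obtain ⟨M', h1, h2, h3, h4⟩ := build f
  refine ⟨M', h1, h2, h3, fun u v => ?_⟩
  rw [hG u v]
  refine and_congr_right fun huv => ?_
  rw [hf u v huv, h4 u v huv]

end CAModel

/-- For `X` among normal, proper, unit: a graph admits an `X` Helly
circular-arc model iff it admits an `X` circular-arc model in which no two arcs and no
three arcs together cover the whole circle. -/
theorem stmt_2 {V : Type} [Fintype V] (G : SimpleGraph V) :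
    ((∃ M : CAModel V, M.Normal ∧ M.Helly ∧ M.IsModelOf G) ↔
      (∃ M : CAModel V, M.Normal ∧ M.Normal ∧ M.NoThreeCover ∧ M.IsModelOf G)) ∧
    ((∃ M : CAModel V, M.Proper ∧ M.Helly ∧ M.IsModelOf G) ↔
      (∃ M : CAModel V, M.Proper ∧ M.Normal ∧ M.NoThreeCover ∧ M.IsModelOf G)) ∧
    ((∃ M : CAModel V, M.IsUnit ∧ M.Helly ∧ M.IsModelOf G) ↔
      (∃ M : CAModel V, M.IsUnit ∧ M.Normal ∧ M.NoThreeCover ∧ M.IsModelOf G)) := by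
  refine ⟨⟨?_, ?_⟩, ⟨?_, ?_⟩, ⟨?_, ?_⟩⟩
  · rintro ⟨M, hN, hH, hG⟩
    exact ⟨M, hN, hN, M.noThree_of_helly hN hH, hG⟩
  · rintro ⟨M, hN, _, hT, hG⟩
    exact ⟨M, hN, M.helly_of_noCover hN hT, hG⟩
  · rintro ⟨M, hP, hH, hG⟩
    by_cases hN : M.Normal
    · exact ⟨M, hP, hN, M.noThree_of_helly hN hH, hG⟩
    · obtain ⟨M', h1, h2, h3, h4⟩ := M.rebuild hP hH hN G hG
      exact ⟨M', M'.proper_of_unit h1, h2, h3, h4⟩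
  · rintro ⟨M, hP, hN, hT, hG⟩
    exact ⟨M, hP, M.helly_of_noCover hN hT, hG⟩
  · rintro ⟨M, hU, hH, hG⟩
    by_cases hN : M.Normal
    · exact ⟨M, hU, hN, M.noThree_of_helly hN hH, hG⟩
    · exact M.rebuild (M.proper_of_unit hU) hH hN G hG
  · rintro ⟨M, hU, hN, hT, hG⟩
    exact ⟨M, hU, M.helly_of_noCover hN hT, hG⟩
end
end

section
/- A circular-arc model M is a normal Helly circular-arc (NHCA) model if and only if, for every arc A of M, the submodel of M induced by the closed neighborhood of A (the subfamily consisting of A together with all arcs of M intersecting A) is an interval model, i.e., some point of the circle is covered by no arc of this subfamily. -/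
open Set

noncomputable section

theorem coord_aux {a b c : ℝ} (ha : 0 ≤ a) (ha1 : a < 1) (hb : 0 ≤ b) (hb1 : b < 1)
    (hc : 0 ≤ c) (hc1 : c < 1) (r : ℝ) :
    sbtw ((r + a : ℝ) : Circ) ((r + b : ℝ) : Circ) ((r + c : ℝ) : Circ) ↔
      ((a < b ∧ b < c) ∨ (b < c ∧ c < a) ∨ (c < a ∧ a < b)) := by
  rw [sbtw_iff_not_btw, QuotientAddGroup.btw_coe_iff]
  have h1 : toIcoMod (Fact.out : (0:ℝ) < 1) (r + c) (r + b) =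
      if c ≤ b then r + b else r + b + 1 := by
    rw [toIcoMod_eq_iff]
    split_ifs with h
    · exact ⟨⟨by linarith, by linarith⟩, 0, by simp⟩
    · exact ⟨⟨by linarith, by linarith⟩, -1, by simp⟩
  have h2 : toIocMod (Fact.out : (0:ℝ) < 1) (r + c) (r + a) =
      if c < a then r + a else r + a + 1 := by
    rw [toIocMod_eq_iff]
    split_ifs with h
    · exact ⟨⟨by linarith, by linarith⟩, 0, by simp⟩
    · exact ⟨⟨by linarith, by linarith⟩, -1, by simp⟩
  rw [h1, h2]
  grind

theorem exists_coord (p : Circ) : ∃ c : Circ → ℝ, c p = 0 ∧ Function.Injective c ∧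
    (∀ x, 0 ≤ c x ∧ c x < 1) ∧ (∀ y, 0 ≤ y → y < 1 → ∃ x, c x = y) ∧
    (∀ A : Arc, ∀ x, x ∈ A.pts ↔ ((c A.s < c x ∧ c x < c A.t) ∨
      (c x < c A.t ∧ c A.t < c A.s) ∨ (c A.t < c A.s ∧ c A.s < c x))) := by
  obtain ⟨r, rfl⟩ := QuotientAddGroup.mk_surjective p
  let e := AddCircle.equivIco (1:ℝ) r
  have hcoe : ∀ x, ((e x : ℝ) : Circ) = x := fun x => e.symm_apply_apply x
  have hmem : ∀ x, r ≤ (e x : ℝ) ∧ (e x : ℝ) < r + 1 := fun x => (e x).2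
  have hsurj : ∀ y : ℝ, r ≤ y → y < r + 1 → (e (y : Circ) : ℝ) = y := by
    intro y h1 h2
    have := e.apply_symm_apply ⟨y, h1, h2⟩
    exact congrArg Subtype.val this
  refine ⟨fun x => (e x : ℝ) - r, ?_, ?_, ?_, ?_, ?_⟩
  · have := hsurj r le_rfl (by linarith)
    simpa [sub_eq_zero] using this
  · intro x y h
    apply e.injective
    apply Subtype.ext
    simpa using h
  · intro x
    have := hmem x
    constructor <;> linarith
  · intro y h0 h1
    refine ⟨((r + y : ℝ) : Circ), ?_⟩
    have := hsurj (r + y) (by linarith) (by linarith)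
    simp only [this]; ring
  · intro A x
    have hs := hmem A.s
    have ht := hmem A.t
    have hx := hmem x
    have := coord_aux (a := (e A.s : ℝ) - r) (b := (e x : ℝ) - r) (c := (e A.t : ℝ) - r)
      (by linarith) (by linarith) (by linarith) (by linarith) (by linarith) (by linarith) r
    simp only [add_sub_cancel, hcoe] at this
    exact this

theorem CAModel.s_ne_t_s3 {V : Type} [Fintype V] (M : CAModel V) (u v : V) :
    (M.arc u).s ≠ (M.arc v).t := by
  intro h
  have := @M.endpoints_distinct (u, true) (v, false) (by simpa using h)
  simp at this

theorem CAModel.s_ne_s_s3 {V : Type} [Fintype V] (M : CAModel V) {u v : V} (h : u ≠ v) :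
    (M.arc u).s ≠ (M.arc v).s := by
  intro h'
  have := @M.endpoints_distinct (u, true) (v, true) (by simpa using h')
  simp at this; exact h this

theorem CAModel.t_ne_t_s3 {V : Type} [Fintype V] (M : CAModel V) {u v : V} (h : u ≠ v) :
    (M.arc u).t ≠ (M.arc v).t := by
  intro h'
  have := @M.endpoints_distinct (u, false) (v, false) (by simpa using h')
  simp at this; exact h this

theorem normal_of_nbhd {V : Type} [Fintype V] (M : CAModel V)
    (H : ∀ v : V, ∃ p : Circ, p ∉ (M.arc v).pts ∧
        ∀ w : V, M.Inter v w → p ∉ (M.arc w).pts) : M.Normal := by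
  intro u v huv hcov
  have hI : M.Inter u v := by
    obtain ⟨c, hc0, hinj, hr, hsurj, hpts⟩ := exists_coord (M.arc u).s
    have h1 : (M.arc u).s ∈ (M.arc u).pts ∪ (M.arc v).pts := hcov ▸ mem_univ _
    have n1 := hinj.ne (M.s_ne_t_s3 u u)
    have n4 := hinj.ne (M.s_ne_t_s3 u v)
    have b1 := hr (M.arc u).t
    have b2 := hr (M.arc v).t
    have b3 := hr (M.arc v).s
    have hmin : 0 < min (c (M.arc u).t) (c (M.arc v).t) := by
      rw [lt_min_iff]; constructor <;> grind
    have l1 := min_le_left (c (M.arc u).t) (c (M.arc v).t)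
    have l2 := min_le_right (c (M.arc u).t) (c (M.arc v).t)
    obtain ⟨x, hx⟩ := hsurj (min (c (M.arc u).t) (c (M.arc v).t) / 2) (by linarith) (by linarith)
    have k1 : c x < c (M.arc u).t := by linarith
    have k2 : c x < c (M.arc v).t := by linarith
    have k3 : 0 < c x := by linarith
    rw [mem_union, hpts, hpts] at h1
    refine ⟨x, ?_, ?_⟩
    · rw [hpts]; grind
    · rw [hpts]; grind
  obtain ⟨p, hp, hq⟩ := H u
  have : p ∈ (M.arc u).pts ∪ (M.arc v).pts := hcov ▸ mem_univ _
  exact this.elim hp (hq v hI)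

theorem helly_of_nbhd {V : Type} [Fintype V] (M : CAModel V)
    (H : ∀ v : V, ∃ p : Circ, p ∉ (M.arc v).pts ∧
        ∀ w : V, M.Inter v w → p ∉ (M.arc w).pts) : M.Helly := by
  intro S hS
  rcases S.eq_empty_or_nonempty with rfl | hne
  · exact ⟨0, by simp⟩
  obtain ⟨v₀, hv₀⟩ := hne
  obtain ⟨p, -, hp⟩ := H v₀
  obtain ⟨c, hc0, hinj, hr, hsurj, hpts⟩ := exists_coord p
  have hmiss : ∀ w ∈ S, p ∉ (M.arc w).pts := fun w hw => hp w (hS v₀ hv₀ w hw)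
  let τ : V → ℝ := fun w => if c (M.arc w).t = 0 then 1 else c (M.arc w).t
  have key : ∀ w ∈ S, ∀ x, x ∈ (M.arc w).pts ↔ c (M.arc w).s < c x ∧ c x < τ w := by
    intro w hw x
    have h1 := hmiss w hw
    rw [hpts] at h1
    rw [hpts]
    have n1 := hinj.ne (M.s_ne_t_s3 w w)
    have b1 := hr (M.arc w).t
    have b2 := hr (M.arc w).s
    have b3 := hr x
    simp only [τ]
    grind
  have hfin : S.Finite := S.toFinite
  obtain ⟨a, haS, ha⟩ := Set.exists_max_image S (fun w => c (M.arc w).s) hfin ⟨v₀, hv₀⟩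
  obtain ⟨b, hbS, hb⟩ := Set.exists_min_image S τ hfin ⟨v₀, hv₀⟩
  have hlt : c (M.arc a).s < τ b := by
    obtain ⟨x, hx1, hx2⟩ := hS a haS b hbS
    rw [key a haS] at hx1
    rw [key b hbS] at hx2
    linarith
  have b1 := hr (M.arc a).s
  have b2 : τ b ≤ 1 := by
    have := hr (M.arc b).t
    simp only [τ]; split_ifs <;> linarith
  obtain ⟨x, hx⟩ := hsurj ((c (M.arc a).s + τ b) / 2) (by linarith) (by linarith)
  refine ⟨x, fun w hw => ?_⟩
  rw [key w hw]
  have := ha w hw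
  have := hb w hw
  constructor <;> linarith

theorem nbhd_of_nhca {V : Type} [Fintype V] (M : CAModel V) (hN : M.Normal) (hH : M.Helly)
    (v : V) : ∃ p : Circ, p ∉ (M.arc v).pts ∧ ∀ w : V, M.Inter v w → p ∉ (M.arc w).pts := by
  by_contra hcon
  push Not at hcon
  obtain ⟨c, hc0, hinj, hr, hsurj, hpts⟩ := exists_coord (M.arc v).t
  have hσ : 0 < c (M.arc v).s := by
    have := hinj.ne (M.s_ne_t_s3 v v)
    have := hr (M.arc v).s
    grind
  -- points of `v` are those with coordinate beyond `σ`
  have hv : ∀ x, x ∈ (M.arc v).pts ↔ c (M.arc v).s < c x := by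
    intro x
    have := hr x
    rw [hpts]; grind
  set σ := c (M.arc v).s with hσdef
  have nself : ∀ w, ¬ (M.arc w).s ∈ (M.arc w).pts := by
    intro w h; rw [hpts] at h; grind
  have hself : ∀ w, c (M.arc w).s ≠ c (M.arc w).t := fun w => hinj.ne (M.s_ne_t_s3 w w)
  have hne : ∀ w, w ≠ v → 0 < c (M.arc w).s ∧ 0 < c (M.arc w).t ∧
      c (M.arc w).s ≠ σ ∧ c (M.arc w).t ≠ σ := by
    intro w hw
    have h1 := hinj.ne (M.s_ne_t_s3 w v)
    have h2 := hinj.ne (M.t_ne_t_s3 hw)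
    have h3 := hinj.ne (M.s_ne_s_s3 hw)
    have h4 := hinj.ne (M.s_ne_t_s3 v w)
    have b1 := hr (M.arc w).s
    have b2 := hr (M.arc w).t
    rw [hc0] at h1 h2
    exact ⟨lt_of_le_of_ne b1.1 (Ne.symm h1), lt_of_le_of_ne b2.1 (Ne.symm h2), h3, Ne.symm h4⟩
  -- by normality no other arc covers `[0, σ]`
  have hnorm : ∀ w, w ≠ v → ∃ x, c x ≤ σ ∧ x ∉ (M.arc w).pts := by
    intro w hw
    by_contra hc
    push Not at hc
    apply hN v w hw.symm
    ext x
    simp only [mem_union, mem_univ, iff_true, hv]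
    by_cases h : c x ≤ σ
    · exact Or.inr (hc x h)
    · exact Or.inl (not_le.mp h)
  have hcov : ∀ x, c x ≤ σ → ∃ w, w ≠ v ∧ M.Inter v w ∧ x ∈ (M.arc w).pts := by
    intro x hx
    have h1 : x ∉ (M.arc v).pts := by rw [hv]; exact not_lt.mpr hx
    obtain ⟨w, hw, hxw⟩ := hcon x h1
    exact ⟨w, fun h => h1 (h ▸ hxw), hw, hxw⟩
  -- arcs containing `0`
  let P : Set V := {w | w ≠ v ∧ M.Inter v w ∧ (M.arc v).t ∈ (M.arc w).pts}
  let Q : Set V := {w | w ≠ v ∧ M.Inter v w ∧ (M.arc v).s ∈ (M.arc w).pts}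
  have hP : ∀ w ∈ P, c (M.arc w).t < c (M.arc w).s ∧ c (M.arc w).t < σ := by
    rintro w ⟨hw, -, hm⟩
    obtain ⟨x, hx, hx'⟩ := hnorm w hw
    have := hne w hw
    rw [hpts] at hm hx'
    grind
  have hQ : ∀ w ∈ Q, c (M.arc w).s < σ ∧
      (c (M.arc w).t < c (M.arc w).s ∨ σ < c (M.arc w).t) := by
    rintro w ⟨hw, -, hm⟩
    obtain ⟨x, hx, hx'⟩ := hnorm w hw
    have := hne w hw
    have := hself w
    rw [hpts] at hm hx'
    grind
  obtain ⟨B, hBP, hBmax⟩ := Set.exists_max_image P (fun w => c (M.arc w).t) P.toFinite (by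
    obtain ⟨w, h⟩ := hcov (M.arc v).t (by rw [hc0]; exact hσ.le)
    exact ⟨w, h⟩)
  obtain ⟨C, hCQ, hCmin⟩ := Set.exists_min_image Q (fun w => c (M.arc w).s) Q.toFinite (by
    obtain ⟨w, h⟩ := hcov (M.arc v).s le_rfl
    exact ⟨w, h⟩)
  have hB := hP B hBP
  have hC := hQ C hCQ
  have hlt : c (M.arc C).s < c (M.arc B).t := by
    by_contra hle
    push Not at hle
    obtain ⟨w, hw, hI, hm⟩ := hcov (M.arc B).t hB.2.le
    have nw := hne w hw
    by_cases h0 : w ∈ P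
    · have h1 := hBmax w h0
      have h2 := hP w h0
      rw [hpts] at hm
      have h3 : w ∈ Q := ⟨hw, hI, by rw [hpts]; grind⟩
      have := hCmin w h3
      grind
    · have h1 : ¬ (M.arc v).t ∈ (M.arc w).pts := fun h => h0 ⟨hw, hI, h⟩
      obtain ⟨y, hy1, hy2⟩ := hI
      rw [hv] at hy1
      rw [hpts] at hy2 h1 hm
      have h3 : w ∈ Q := ⟨hw, ⟨y, by rw [hv]; exact hy1, by rw [hpts]; exact hy2⟩, by
        rw [hpts]; grind⟩
      have := hCmin w h3
      grind
  have nB := hne B hBP.1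
  have nC := hne C hCQ.1
  have bC := hr (M.arc C).s
  have bB := hr (M.arc B).t
  have hBC : M.Inter B C := by
    obtain ⟨x, hx⟩ := hsurj ((c (M.arc C).s + c (M.arc B).t) / 2) (by linarith) (by linarith)
    have k1 : c (M.arc C).s < c x := by linarith
    have k2 : c x < c (M.arc B).t := by linarith
    refine ⟨x, ?_, ?_⟩
    · rw [hpts]; grind
    · rw [hpts]; grind
  have symm : ∀ a b, M.Inter a b → M.Inter b a := by
    rintro a b ⟨x, h1, h2⟩; exact ⟨x, h2, h1⟩
  have refl : ∀ a b, M.Inter a b → M.Inter a a := by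
    rintro a b ⟨x, h1, h2⟩; exact ⟨x, h1, h1⟩
  obtain ⟨p, hp⟩ := hH {v, B, C} (by
    have i1 := hBP.2.1
    have i2 := hCQ.2.1
    rintro a (rfl | rfl | rfl) b (rfl | rfl | rfl) <;>
    first | assumption | exact symm _ _ (by assumption) | exact refl _ _ (by assumption) |
      exact refl _ _ (symm _ _ (by assumption)))
  have pv := hp v (by simp)
  have pB := hp B (by simp)
  have pC := hp C (by simp)
  rw [hv] at pv
  rw [hpts] at pB pC
  have hall : ∀ x, x ∈ (M.arc B).pts ∨ x ∈ (M.arc C).pts := by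
    intro x
    rw [hpts, hpts]
    have := hr x
    grind
  by_cases hEq : B = C
  · subst hEq
    exact nself B (by simpa using hall (M.arc B).s)
  · apply hN B C hEq
    ext x
    simpa using hall x

/-- A circular-arc model is normal and Helly iff for every arc `A`, the
submodel induced by the closed neighborhood of `A` (`A` together with all arcs
intersecting it) is an interval model, i.e. some point of the circle is covered by no
arc of this subfamily. -/
theorem stmt_3 {V : Type} [Fintype V] (M : CAModel V) :
    (M.Normal ∧ M.Helly) ↔
      ∀ v : V, ∃ p : Circ, p ∉ (M.arc v).pts ∧
        ∀ w : V, M.Inter v w → p ∉ (M.arc w).pts := by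
  exact ⟨fun h v => nbhd_of_nhca M h.1 h.2 v, fun H => ⟨normal_of_nbhd M H, helly_of_nbhd M H⟩⟩
end
end

section
/- Let G be a normal Helly circular-arc (NHCA) graph. Then G is a proper Helly circular-arc (PHCA) graph if and only if G contains no induced subgraph isomorphic to K_{1,3}. -/
open Set

noncomputable section

/-- `p` lies on the circular arc given by the real lift `(a v, b v)`. -/
def OnArc {V : Type} (a b : V → ℝ) (v : V) (p : ℝ) : Prop :=
  ∃ n : ℤ, a v < p + n ∧ p + n < b v

theorem sbtw_coe_iff_aux {a b p : ℝ} (h1 : a < b) (h2 : b < a + 1) :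
    sbtw (a : Circ) (p : Circ) (b : Circ) ↔ ∃ n : ℤ, a < p + n ∧ p + n < b := by
  have e : toIocMod (one_pos : (0:ℝ) < 1) b a = a + 1 := by
    rw [toIocMod_eq_iff]
    exact ⟨⟨h2, by linarith⟩, -1, by simp⟩
  rw [sbtw_iff_not_btw]
  have : btw (b : Circ) (p : Circ) (a : Circ) ↔
      toIcoMod (one_pos : (0:ℝ) < 1) b p ≤ toIocMod (one_pos : (0:ℝ) < 1) b a :=
    QuotientAddGroup.btw_coe_iff
  rw [this, e, not_le]
  have hm := toIcoMod_mem_Ico (one_pos : (0:ℝ) < 1) b p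
  have hd := self_sub_toIcoDiv_zsmul (one_pos : (0:ℝ) < 1) b p
  constructor
  · intro h
    refine ⟨-toIcoDiv (one_pos : (0:ℝ) < 1) b p - 1, ?_, ?_⟩
    · push_cast
      simp at hd hm
      linarith
    · push_cast
      simp at hd hm
      linarith [hm.2]
  · rintro ⟨n, h3, h4⟩
    have : toIcoMod (one_pos : (0:ℝ) < 1) b p = p + n + 1 := by
      rw [toIcoMod_eq_iff]
      refine ⟨⟨by linarith, by linarith⟩, -n - 1, by simp⟩
    rw [this]; linarith

theorem coe_eq_coe_aux {x y : ℝ} : (x : Circ) = (y : Circ) ↔ ∃ n : ℤ, x = y + n := by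
  rw [← sub_eq_zero, ← AddCircle.coe_sub, AddCircle.coe_eq_zero_iff]
  constructor
  · rintro ⟨n, h⟩
    exact ⟨n, by simp at h; linarith⟩
  · rintro ⟨n, h⟩
    exact ⟨n, by simp; linarith⟩

theorem exists_lift_aux {V : Type} [Fintype V] (M : CAModel V) : ∃ a b : V → ℝ,
    (∀ v, a v < b v) ∧ (∀ v, b v < a v + 1) ∧
    (∀ v (p : ℝ), (p : Circ) ∈ (M.arc v).pts ↔ OnArc a b v p) ∧
    (∀ v, (a v : Circ) = (M.arc v).s) ∧ (∀ v, (b v : Circ) = (M.arc v).t) := by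
  have key : ∀ v, ∃ ab : ℝ × ℝ, ab.1 < ab.2 ∧ ab.2 < ab.1 + 1 ∧
      (ab.1 : Circ) = (M.arc v).s ∧ (ab.2 : Circ) = (M.arc v).t := by
    intro v
    obtain ⟨a, ha⟩ := QuotientAddGroup.mk_surjective (M.arc v).s
    obtain ⟨b, hb⟩ := QuotientAddGroup.mk_surjective (M.arc v).t
    have hne : (M.arc v).s ≠ (M.arc v).t := by
      intro h
      have := @M.endpoints_distinct (v, true) (v, false) (by simpa using h)
      simp at this
    have hm := toIocMod_mem_Ioc (one_pos : (0:ℝ) < 1) a b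
    have hd := self_sub_toIocDiv_zsmul (one_pos : (0:ℝ) < 1) a b
    have hb' : ((toIocMod (one_pos : (0:ℝ) < 1) a b : ℝ) : Circ) = (M.arc v).t := by
      rw [← hb]
      exact coe_eq_coe_aux.2 ⟨-toIocDiv (one_pos : (0:ℝ) < 1) a b, by
        simp at hd; push_cast; linarith⟩
    refine ⟨(a, toIocMod (one_pos : (0:ℝ) < 1) a b), hm.1, lt_of_le_of_ne hm.2 ?_, ha, hb'⟩
    intro h
    apply hne
    rw [← hb', ← ha]
    exact coe_eq_coe_aux.2 ⟨-1, by dsimp only at h; rw [h]; push_cast; ring⟩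
  choose ab h1 h2 h3 h4 using key
  refine ⟨fun v => (ab v).1, fun v => (ab v).2, h1, h2, ?_, h3, h4⟩
  intro v p
  rw [Arc.pts, Set.mem_ofPred_eq, ← h3, ← h4, sbtw_coe_iff_aux (h1 v) (h2 v)]
  rfl

theorem inter_iff_aux {V : Type} [Fintype V] (M : CAModel V) (a b : V → ℝ)
    (h : ∀ v (p : ℝ), (p : Circ) ∈ (M.arc v).pts ↔ OnArc a b v p) (u v : V) :
    M.Inter u v ↔ ∃ p, OnArc a b u p ∧ OnArc a b v p := by
  constructor
  · rintro ⟨x, hx⟩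
    obtain ⟨p, rfl⟩ := QuotientAddGroup.mk_surjective x
    exact ⟨p, (h u p).1 hx.1, (h v p).1 hx.2⟩
  · rintro ⟨p, h1, h2⟩
    exact ⟨p, (h u p).2 h1, (h v p).2 h2⟩

theorem not_onArc_left {V : Type} {a b : V → ℝ} {v : V} (h2 : b v < a v + 1) (n : ℤ) :
    ¬ OnArc a b v (a v + n) := by
  rintro ⟨m, h3, h4⟩
  have h5 : (0:ℝ) < ((n + m : ℤ) : ℝ) := by push_cast; linarith
  have h6 : ((n + m : ℤ) : ℝ) < 1 := by push_cast; linarith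
  norm_cast at h5 h6
  omega

theorem not_onArc_right {V : Type} {a b : V → ℝ} {v : V} (h2 : b v < a v + 1) (n : ℤ) :
    ¬ OnArc a b v (b v + n) := by
  rintro ⟨m, h3, h4⟩
  have h5 : ((n + m : ℤ) : ℝ) < 0 := by push_cast; linarith
  have h6 : (-1:ℝ) < ((n + m : ℤ) : ℝ) := by push_cast; linarith
  norm_cast at h5 h6
  omega

theorem onArc_add_int {V : Type} {a b : V → ℝ} {v : V} {p : ℝ} (n : ℤ) :
    OnArc a b v (p + n) ↔ OnArc a b v p := by
  constructor
  · rintro ⟨m, h⟩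
    exact ⟨n + m, by push_cast; rwa [← add_assoc]⟩
  · rintro ⟨m, h⟩
    refine ⟨m - n, ?_⟩
    have : p + n + ((m - n : ℤ) : ℝ) = p + m := by push_cast; ring
    rwa [this]

/-- Proper circular-arc graphs are claw-free. -/
theorem proper_claw_free {V : Type} [Fintype V] (G : SimpleGraph V) (M : CAModel V)
    (hP : M.Proper) (hM : M.IsModelOf G) : IsEmpty (claw ↪g G) := by
  constructor
  intro φ
  obtain ⟨a, b, h1, h2, h3, h4, h5⟩ := exists_lift_aux M
  have hI := inter_iff_aux M a b h3
  have adj : ∀ i : Fin 4, i ≠ 0 → OnArc a b (φ i) (a (φ 0)) ∨ OnArc a b (φ i) (b (φ 0)) := by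
    intro i hi
    have hA : G.Adj (φ 0) (φ i) := by
      rw [φ.map_adj_iff, claw, SimpleGraph.fromRel_adj]
      exact ⟨hi.symm, Or.inl rfl⟩
    obtain ⟨hne, hint⟩ := (hM _ _).1 hA
    obtain ⟨p, ⟨m, hm1, hm2⟩, ⟨k, hk1, hk2⟩⟩ := (hI _ _).1 hint
    generalize φ 0 = u at *
    generalize φ i = v at *
    by_contra hcon
    push Not at hcon
    obtain ⟨hc1, hc2⟩ := hcon
    have e1 : a u ≤ a v + (m - k) := by
      by_contra hlt
      exact hc1 ⟨k - m, by push_cast; linarith, by push_cast; linarith⟩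
    have e2 : b v + (m - k) ≤ b u := by
      by_contra hlt
      exact hc2 ⟨k - m, by push_cast; linarith, by push_cast; linarith⟩
    have hane : a u ≠ a v + (m - k) := by
      intro h
      have : (a u : Circ) = (a v : Circ) := coe_eq_coe_aux.2 ⟨m - k, by push_cast; exact h⟩
      rw [h4, h4] at this
      have := @M.endpoints_distinct (u, true) (v, true) (by simpa using this)
      simp at this
      exact hne this
    have e1' : a u < a v + (m - k) := lt_of_le_of_ne (by linarith) hane
    apply hP v u hne.symm
    refine ⟨?_, ?_⟩
    · intro x hx
      obtain ⟨p, rfl⟩ := QuotientAddGroup.mk_surjective x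
      obtain ⟨n, hn1, hn2⟩ := (h3 v p).1 hx
      refine (h3 u p).2 ⟨n + (m - k), ?_, ?_⟩ <;> push_cast <;> linarith
    · intro hsub
      have : ((a v : ℝ) : Circ) ∈ (M.arc u).pts :=
        (h3 u _).2 ⟨m - k, by push_cast; linarith, by push_cast; linarith [h1 v]⟩
      have := (h3 v _).1 (hsub this)
      have h0 := not_onArc_left (h2 v) 0
      simp at h0
      exact h0 this
  have nadj : ∀ i j : Fin 4, i ≠ 0 → j ≠ 0 → i ≠ j → ∀ p, OnArc a b (φ i) p →
      OnArc a b (φ j) p → False := by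
    intro i j hi hj hij p hp1 hp2
    have : G.Adj (φ i) (φ j) :=
      (hM _ _).2 ⟨fun h => hij (φ.injective h), (hI _ _).2 ⟨p, hp1, hp2⟩⟩
    rw [φ.map_adj_iff, claw, SimpleGraph.fromRel_adj] at this
    tauto
  have n12 := nadj 1 2 (by decide) (by decide) (by decide)
  have n13 := nadj 1 3 (by decide) (by decide) (by decide)
  have n23 := nadj 2 3 (by decide) (by decide) (by decide)
  have a1 := adj 1 (by decide)
  have a2 := adj 2 (by decide)
  have a3 := adj 3 (by decide)
  rcases a1 with a1 | a1 <;> rcases a2 with a2 | a2 <;> rcases a3 with a3 | a3 <;>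
    first
      | exact n12 _ a1 a2
      | exact n13 _ a1 a3
      | exact n23 _ a2 a3

theorem exists_points {V : Type} [Finite V] (a b : V → ℝ) : ∃ (Q : Set ℝ) (ε : ℝ), 0 < ε ∧
    (∀ p, ∃ q ∈ Q, ∀ v, OnArc a b v p → OnArc a b v q) ∧
    (∀ q ∈ Q, ∀ n : ℤ, q + n ∈ Q) ∧
    (∀ q ∈ Q, ∀ q' ∈ Q, (∀ v, OnArc a b v q → OnArc a b v q') → ∃ n : ℤ, q' = q + n) ∧
    (∀ q ∈ Q, ∀ q' ∈ Q, q < q' → q + 2 * ε < q') ∧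
    (∀ x y, (Q ∩ Set.Ioo x y).Finite) := by
  classical
  let S : ℝ → Set V := fun p => {v | OnArc a b v p}
  let T := {A : Set V // Maximal (fun A => A ∈ Set.range S) A}
  have hT : Finite T := inferInstance
  have hrep : ∀ A : T, ∃ q : ℝ, 0 ≤ q ∧ q < 1 ∧ S q = A.1 := by
    intro A
    obtain ⟨p, hp⟩ := A.2.1
    refine ⟨Int.fract p, Int.fract_nonneg p, Int.fract_lt_one p, ?_⟩
    rw [← hp]
    ext v
    have : Int.fract p = p + ((-⌊p⌋ : ℤ) : ℝ) := by
      push_cast; rw [Int.fract]; ring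
    change OnArc a b v _ ↔ OnArc a b v _
    rw [this, onArc_add_int]
  choose q hq0 hq1 hqS using hrep
  have hε : ∀ᶠ ε in nhdsWithin (0:ℝ) (Set.Ioi 0), 0 < ε ∧ 2 * ε < 1 ∧ ∀ A B : T, 
      (q A < q B → 2 * ε < q B - q A) ∧ 2 * ε < 1 - (q B - q A) := by
    have small : ∀ c : ℝ, 0 < c → ∀ᶠ ε in nhdsWithin (0:ℝ) (Set.Ioi 0), 2 * ε < c := by
      intro c hc
      have : Set.Ioo (0:ℝ) (c / 2) ∈ nhdsWithin (0:ℝ) (Set.Ioi 0) :=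
        Ioo_mem_nhdsGT (by linarith)
      filter_upwards [this] with ε hε
      linarith [hε.2]
    refine (eventually_mem_nhdsWithin).and ((small 1 one_pos).and ?_)
    rw [Filter.eventually_all]
    intro A
    rw [Filter.eventually_all]
    intro B
    refine Filter.Eventually.and ?_ (small _ (by linarith [hq0 A, hq1 B]))
    by_cases h : q A < q B
    · filter_upwards [small _ (sub_pos.2 h)] with ε he _
      exact he
    · exact Filter.Eventually.of_forall fun ε h' => absurd h' h
  obtain ⟨ε, hε0, hε1, hε⟩ := hε.exists
  refine ⟨{z | ∃ (A : T) (n : ℤ), z = q A + n}, ε, hε0, ?_, ?_, ?_, ?_, ?_⟩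
  · intro p
    obtain ⟨A, hA, hmax⟩ := (Set.toFinite (Set.range S)).exists_le_maximal (Set.mem_range_self p)
    refine ⟨q ⟨A, hmax⟩, ⟨⟨A, hmax⟩, 0, by simp⟩, ?_⟩
    intro v hv
    have : v ∈ A := hA hv
    have h2 : v ∈ S (q ⟨A, hmax⟩) := by rw [hqS]; exact this
    exact h2
  · rintro _ ⟨A, n, rfl⟩ m
    exact ⟨A, n + m, by push_cast; ring⟩
  · rintro _ ⟨A, n, rfl⟩ _ ⟨B, m, rfl⟩ h
    simp only [onArc_add_int] at h
    have hAB : A.1 ⊆ B.1 := by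
      rw [← hqS A, ← hqS B]; exact h
    have : A = B := Subtype.ext (A.2.eq_of_le B.2.1 hAB)
    subst this
    exact ⟨m - n, by push_cast; ring⟩
  · rintro _ ⟨A, n, rfl⟩ _ ⟨B, m, rfl⟩ h
    have hnm : n ≤ m := by
      by_contra hc
      have : (m:ℝ) + 1 ≤ n := by exact_mod_cast (by omega : m + 1 ≤ n)
      linarith [hq0 A, hq1 B]
    rcases hnm.eq_or_lt with rfl | hlt
    · linarith [(hε A B).1 (by linarith)]
    · have : (n:ℝ) + 1 ≤ m := by exact_mod_cast hlt
      linarith [(hε B A).2]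
  · intro x y
    refine ((Set.finite_univ : (Set.univ : Set T).Finite).prod
      (Set.finite_Icc (⌊x⌋ - 1) ⌈y⌉)).image (fun An : T × ℤ => q An.1 + An.2) |>.subset ?_
    rintro _ ⟨⟨A, n, rfl⟩, h1, h2⟩
    refine ⟨(A, n), ⟨trivial, ?_, ?_⟩, rfl⟩
    · have : (⌊x⌋ : ℝ) < n + 1 := by linarith [Int.floor_le x, hq1 A]
      have : ⌊x⌋ < n + 1 := by exact_mod_cast this
      change ⌊x⌋ - 1 ≤ n
      omega
    · have : (n : ℝ) < ⌈y⌉ := by linarith [Int.le_ceil y, hq0 A]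
      have : n < ⌈y⌉ := by exact_mod_cast this
      exact this.le

theorem exists_ranks {V : Type} [Finite V] (l : V → ℝ) (hl : ∀ v, 0 ≤ l v ∧ l v < 1) :
    ∃ f g : V → ℝ, (∀ v, 0 < f v ∧ f v < 1) ∧ (∀ v, 0 < g v ∧ g v < 1) ∧
      Function.Injective f ∧ Function.Injective g ∧
      (∀ v w, l v < l w → f w < f v ∧ g w < g v) ∧
      (∀ v w, l v = l w → f v < f w → g w < g v) := by
  obtain ⟨N, ⟨e⟩⟩ := Finite.exists_equiv_fin V
  let τ : V → ℝ := fun v => ((e v : ℕ) : ℝ)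
  have hτ0 : ∀ v, 0 ≤ τ v := fun v => Nat.cast_nonneg _
  have hτN : ∀ v, τ v ≤ N := fun v => Nat.cast_le.2 (e v).2.le
  have hτi : Function.Injective τ := by
    intro v w h
    apply e.injective
    apply Fin.ext
    exact Nat.cast_injective h
  have small : ∀ c : ℝ, 0 < c → ∀ᶠ d : ℝ in nhdsWithin (0:ℝ) (Set.Ioi 0), d * N < c := by
    intro c hc
    have : Set.Ioo (0:ℝ) (c / (N + 1)) ∈ nhdsWithin (0:ℝ) (Set.Ioi 0) :=
      Ioo_mem_nhdsGT (by positivity)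
    filter_upwards [this] with d hd
    have := hd.2
    rw [lt_div_iff₀ (by positivity)] at this
    linarith [hd.1]
  have hd : ∀ᶠ d : ℝ in nhdsWithin (0:ℝ) (Set.Ioi 0), 0 < d ∧ d * N < 1 ∧ ∀ v w : V,
      l v < l w → d * N < l w - l v := by
    refine (eventually_mem_nhdsWithin).and ((small 1 one_pos).and ?_)
    rw [Filter.eventually_all]
    intro A
    rw [Filter.eventually_all]
    intro B
    by_cases h : l A < l B
    · filter_upwards [small _ (sub_pos.2 h)] with ε he _
      exact he
    · exact Filter.Eventually.of_forall fun ε h' => absurd h' h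
  obtain ⟨d, hd0, hd1, hd⟩ := hd.exists
  have k0 : ∀ v, 0 ≤ d * τ v := fun v => mul_nonneg hd0.le (hτ0 v)
  have k1 : ∀ v, d * τ v ≤ d * N := fun v => mul_le_mul_of_nonneg_left (hτN v) hd0.le
  have hinj : ∀ v w, l v = l w → d * τ v = d * τ w → v = w := by
    intro v w _ h
    exact hτi (mul_left_cancel₀ hd0.ne' h)
  refine ⟨fun v => (2 - l v + d * τ v) / 4, fun v => (2 - l v - d * τ v) / 4, ?_, ?_, ?_, ?_,
    ?_, ?_⟩
  · intro v
    have := hl v; have := k0 v; have := k1 v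
    constructor <;> dsimp only <;> linarith
  · intro v
    have := hl v; have := k0 v; have := k1 v
    constructor <;> dsimp only <;> linarith
  · intro v w h
    dsimp only at h
    have := k0 v; have := k1 v; have := k0 w; have := k1 w
    rcases lt_trichotomy (l v) (l w) with h1 | h1 | h1
    · have := hd _ _ h1
      linarith
    · exact hinj v w h1 (by linarith)
    · have := hd _ _ h1
      linarith
  · intro v w h
    dsimp only at h
    have := k0 v; have := k1 v; have := k0 w; have := k1 w
    rcases lt_trichotomy (l v) (l w) with h1 | h1 | h1
    · have := hd _ _ h1
      linarith
    · exact hinj v w h1 (by linarith)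
    · have := hd _ _ h1
      linarith
  · intro v w h
    have := k0 v; have := k1 v; have := k0 w; have := k1 w
    have := hd _ _ h
    constructor <;> dsimp only <;> linarith
  · intro v w h h2
    dsimp only at *
    linarith

/-- Two lifted arcs that together cover the circle contradict normality. -/
theorem shift_eq_zero {V : Type} {a b : V → ℝ}
    (hN : ∀ u v, u ≠ v → ∃ p, ¬ OnArc a b u p ∧ ¬ OnArc a b v p)
    {v c : V} (hvc : v ≠ c) {z : ℝ} {k m : ℤ}
    (hz1 : a v < z) (hz2 : z < b v) (hk1 : a c < z + k) (hk2 : z + k < b c)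
    {p : ℝ} (hp1 : a v < p) (hp2 : p < b v) (hm1 : a c < p + m) (hm2 : p + m < b c) :
    m = k := by
  have cover : ∀ (z p : ℝ) (k m : ℤ), a v < z → a c < z + k → z + k < b c → p < b v → 
      a c < p + m → m < k → False := by
    intro z p k m hz hk1 hk2 hp hm hmk
    have hmk' : (m:ℝ) + 1 ≤ k := by exact_mod_cast hmk
    obtain ⟨r, hr1, hr2⟩ := hN v c hvc
    have hm := toIocMod_mem_Ioc (one_pos : (0:ℝ) < 1) (a v) r
    have hd := self_sub_toIocDiv_zsmul (one_pos : (0:ℝ) < 1) (a v) r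
    generalize toIocMod (one_pos : (0:ℝ) < 1) (a v) r = r' at *
    generalize toIocDiv (one_pos : (0:ℝ) < 1) (a v) r = n at *
    simp at hd hm
    by_cases h : r' < b v
    · exact hr1 ⟨-n, by push_cast; linarith, by push_cast; linarith⟩
    · exact hr2 ⟨-n - 1 + k, by push_cast; linarith, by push_cast; linarith⟩
  rcases lt_trichotomy m k with h | h | h
  · exact (cover z p k m hz1 hk1 hk2 hp2 hm1 h).elim
  · exact h
  · exact (cover p z m k hp1 hm1 hm2 hz2 hk1 h).elim

theorem core_s4 {V : Type} [Finite V] (a b : V → ℝ)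
    (hab : ∀ v, a v < b v) (hb : ∀ v, b v < a v + 1)
    (hN : ∀ u v, u ≠ v → ∃ p, ¬ OnArc a b u p ∧ ¬ OnArc a b v p)
    (hH : ∀ S : Set V, (∀ u ∈ S, ∀ v ∈ S, ∃ p, OnArc a b u p ∧ OnArc a b v p) →
      ∃ p, ∀ v ∈ S, OnArc a b v p)
    (hC : ∀ v c w d : V,
      (∃ p, OnArc a b v p ∧ OnArc a b c p) → (∃ p, OnArc a b v p ∧ OnArc a b w p) →
      (∃ p, OnArc a b v p ∧ OnArc a b d p) → (¬ ∃ p, OnArc a b c p ∧ OnArc a b w p) →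
      (¬ ∃ p, OnArc a b c p ∧ OnArc a b d p) → (¬ ∃ p, OnArc a b w p ∧ OnArc a b d p) → False) :
    ∃ x y : V → ℝ, (∀ v, x v < y v) ∧ (∀ v, y v < x v + 1) ∧
      (∀ v w (n : ℤ), x v = x w + n → v = w) ∧ (∀ v w (n : ℤ), y v = y w + n → v = w) ∧
      (∀ v w (n : ℤ), x v ≠ y w + n) ∧
      (∀ u v, (∃ p, OnArc x y u p ∧ OnArc x y v p) ↔ ∃ p, OnArc a b u p ∧ OnArc a b v p) ∧
      (∀ S : Set V, (∀ u ∈ S, ∀ v ∈ S, ∃ p, OnArc x y u p ∧ OnArc x y v p) →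
        ∃ p, ∀ v ∈ S, OnArc x y v p) ∧
      (∀ v w, v ≠ w → ∀ n : ℤ, x v ≤ x w + n → y w + n ≤ y v → False) := by
  obtain ⟨Q, ε, hε, hQ1, hQ2, hQ3, hQ4, hQ5⟩ := exists_points a b
  have hne : ∀ v, (Q ∩ Set.Ioo (a v) (b v)).Nonempty := by
    intro v
    obtain ⟨q, hq, h⟩ := hQ1 ((a v + b v) / 2)
    obtain ⟨n, h1, h2⟩ := h v ⟨0, by push_cast; linarith [hab v], by push_cast; linarith [hab v]⟩
    exact ⟨q + n, hQ2 q hq n, h1, h2⟩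
  have hα : ∀ v, ∃ z ∈ Q ∩ Set.Ioo (a v) (b v), ∀ z' ∈ Q ∩ Set.Ioo (a v) (b v), z ≤ z' :=
    fun v => Set.exists_min_image _ id (hQ5 _ _) (hne v)
  have hβ : ∀ v, ∃ z ∈ Q ∩ Set.Ioo (a v) (b v), ∀ z' ∈ Q ∩ Set.Ioo (a v) (b v), z' ≤ z :=
    fun v => Set.exists_max_image _ id (hQ5 _ _) (hne v)
  choose α hα1 hα2 using hα
  choose β hβ1 hβ2 using hβ
  have hαβ : ∀ v, α v ≤ β v := fun v => hα2 v _ (hβ1 v)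
  have hαa : ∀ v, a v < α v := fun v => (hα1 v).2.1
  have hαb : ∀ v, α v < b v := fun v => (hα1 v).2.2
  have hβa : ∀ v, a v < β v := fun v => (hβ1 v).2.1
  have hβb : ∀ v, β v < b v := fun v => (hβ1 v).2.2
  have hαQ : ∀ v, α v ∈ Q := fun v => (hα1 v).1
  have hβQ : ∀ v, β v ∈ Q := fun v => (hβ1 v).1
  obtain ⟨f, g, hf, hg, hfi, hgi, hfg1, hfg2⟩ := exists_ranks (fun v => β v - α v)
    (fun v => ⟨by linarith [hαβ v], by linarith [hαa v, hβb v, hb v]⟩)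
  have hεf : ∀ v, 0 < ε * f v ∧ ε * f v < ε := fun v =>
    ⟨mul_pos hε (hf v).1, by nlinarith [(hf v).2]⟩
  have hεg : ∀ v, 0 < ε * g v ∧ ε * g v < ε := fun v =>
    ⟨mul_pos hε (hg v).1, by nlinarith [(hg v).2]⟩
  have hlen : ∀ v, β v + 2 * ε < α v + 1 := by
    intro v
    have := hQ2 _ (hαQ v) 1
    push_cast at this
    exact hQ4 _ (hβQ v) _ this (by linarith [hαa v, hβb v, hb v])
  -- every point of `Q` on an old arc is on the new one
  have hold : ∀ v, ∀ q ∈ Q, OnArc a b v q →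
      OnArc (fun v => α v - ε * f v) (fun v => β v + ε * g v) v q := by
    rintro v q hq ⟨n, h1, h2⟩
    have m : q + n ∈ Q ∩ Set.Ioo (a v) (b v) := ⟨hQ2 q hq n, h1, h2⟩
    exact ⟨n, by have := hα2 v _ m; dsimp only; linarith [(hεf v).1],
      by have := hβ2 v _ m; dsimp only; linarith [(hεg v).1]⟩
  have hinter : ∀ u v, (∃ p, OnArc (fun v => α v - ε * f v) (fun v => β v + ε * g v) u p ∧
      OnArc (fun v => α v - ε * f v) (fun v => β v + ε * g v) v p) ↔
      ∃ p, OnArc a b u p ∧ OnArc a b v p := by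
    intro u v
    constructor
    · rintro ⟨p, ⟨n, h1, h2⟩, ⟨m, h3, h4⟩⟩
      dsimp only at *
      have e1 : α u - n ≤ β v - m := by
        by_contra hc
        have q1 := hQ2 _ (hαQ u) (-n)
        have q2 := hQ2 _ (hβQ v) (-m)
        push_cast at q1 q2
        have := hQ4 _ q2 _ q1 (by linarith)
        linarith [(hεf u).2, (hεg v).2]
      have e2 : α v - m ≤ β u - n := by
        by_contra hc
        have q1 := hQ2 _ (hαQ v) (-m)
        have q2 := hQ2 _ (hβQ u) (-n)
        push_cast at q1 q2
        have := hQ4 _ q2 _ q1 (by linarith)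
        linarith [(hεf v).2, (hεg u).2]
      refine ⟨max (α u - n) (α v - m), ⟨n, ?_, ?_⟩, ⟨m, ?_, ?_⟩⟩
      · linarith [le_max_left (α u - n) (α v - m), hαa u]
      · have : max (α u - n) (α v - m) ≤ β u - n := max_le (by linarith [hαβ u]) e2
        linarith [hβb u]
      · linarith [le_max_right (α u - n) (α v - m), hαa v]
      · have : max (α u - n) (α v - m) ≤ β v - m := max_le e1 (by linarith [hαβ v])
        linarith [hβb v]
    · rintro ⟨p, h1, h2⟩
      obtain ⟨q, hq, h⟩ := hQ1 p
      exact ⟨q, hold u q hq (h u h1), hold v q hq (h v h2)⟩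
  refine ⟨fun v => α v - ε * f v, fun v => β v + ε * g v, ?_, ?_, ?_, ?_, ?_, hinter, ?_, ?_⟩
  · intro v
    dsimp only
    linarith [hαβ v, (hεf v).1, (hεg v).1]
  · intro v
    dsimp only
    linarith [hlen v, (hεf v).2, (hεg v).2]
  · intro v w n h
    dsimp only at h
    have q1 := hQ2 _ (hαQ w) n
    have : α v = α w + n := by
      rcases lt_trichotomy (α v) (α w + n) with h1 | h1 | h1
      · have := hQ4 _ (hαQ v) _ q1 h1
        linarith [(hεf v).1, (hεf w).2]
      · exact h1
      · have := hQ4 _ q1 _ (hαQ v) h1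
        linarith [(hεf w).1, (hεf v).2]
    exact hfi (mul_left_cancel₀ hε.ne' (by linarith))
  · intro v w n h
    dsimp only at h
    have q1 := hQ2 _ (hβQ w) n
    have : β v = β w + n := by
      rcases lt_trichotomy (β v) (β w + n) with h1 | h1 | h1
      · have := hQ4 _ (hβQ v) _ q1 h1
        linarith [(hεg w).1, (hεg v).2]
      · exact h1
      · have := hQ4 _ q1 _ (hβQ v) h1
        linarith [(hεg v).1, (hεg w).2]
    exact hgi (mul_left_cancel₀ hε.ne' (by linarith))
  · intro v w n h
    dsimp only at h
    have q1 := hQ2 _ (hβQ w) n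
    rcases lt_or_ge (β w + n) (α v) with h1 | h1
    · have := hQ4 _ q1 _ (hαQ v) h1
      linarith [(hεf v).2, (hεg w).2]
    · linarith [(hεf v).1, (hεg w).1]
  · intro S hS
    obtain ⟨p, hp⟩ := hH S (fun u hu v hv => (hinter u v).1 (hS u hu v hv))
    obtain ⟨q, hq, h⟩ := hQ1 p
    exact ⟨q, fun v hv => hold v q hq (h v (hp v hv))⟩
  · intro v w hvw n hx hy
    dsimp only at hx hy
    have qα := hQ2 _ (hαQ w) n
    have qβ := hQ2 _ (hβQ w) n
    have hα' : α v ≤ α w + n := by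
      by_contra hc
      have := hQ4 _ qα _ (hαQ v) (by linarith)
      linarith [(hεf v).2, (hεf w).1]
    have hβ' : β w + n ≤ β v := by
      by_contra hc
      have := hQ4 _ (hβQ v) _ qβ (by linarith)
      linarith [(hεg v).2, (hεg w).1]
    rcases hα'.eq_or_lt with e1 | e1 <;> rcases hβ'.eq_or_lt with e2 | e2
    · have k1 : f w ≤ f v := le_of_mul_le_mul_left (by linarith) hε
      have k2 : g w ≤ g v := le_of_mul_le_mul_left (by linarith) hε
      have k3 : f w < f v := lt_of_le_of_ne k1 (fun h => hvw (hfi h).symm)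
      have := hfg2 w v (by linarith) k3
      linarith
    · have k1 : f w ≤ f v := le_of_mul_le_mul_left (by linarith) hε
      have := (hfg1 w v (by linarith)).1
      linarith
    · have k2 : g w ≤ g v := le_of_mul_le_mul_left (by linarith) hε
      have := (hfg1 w v (by linarith)).2
      linarith
    · -- a claw
      have hsep : ∀ z ∈ Q, ∀ z' ∈ Q, a v < z → z < b v → a v < z' → z' < b v → z ≠ z' →
          ∃ c, OnArc a b c z ∧ ¬ OnArc a b c z' := by
        intro z hz z' hz' h1 h2 h3 h4 hne
        by_contra hcon
        push Not at hcon
        obtain ⟨k, hk⟩ := hQ3 z hz z' hz' hcon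
        have i1 : (k:ℝ) < 1 := by linarith [hb v]
        have i2 : (-1:ℝ) < k := by linarith [hb v]
        have i1' : k < 1 := by exact_mod_cast i1
        have i2' : -1 < k := by exact_mod_cast i2
        have : k = 0 := by omega
        subst this
        simp at hk
        exact hne hk.symm
      have hw := hαβ w
      have hva := hαa v
      have hvb := hβb v
      have Vα : OnArc a b v (α v) := ⟨0, by simpa using hαa v, by simpa using hαb v⟩
      have Vβ : OnArc a b v (β v) := ⟨0, by simpa using hβa v, by simpa using hβb v⟩
      have Vw : OnArc a b v (α w + n) := ⟨0, by push_cast; linarith, by push_cast; linarith⟩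
      have Vw' : OnArc a b v (β w + n) := ⟨0, by push_cast; linarith, by push_cast; linarith⟩
      have Ww : OnArc a b w (α w + n) := by
        rw [onArc_add_int]; exact ⟨0, by simpa using hαa w, by simpa using hαb w⟩
      obtain ⟨c, hc1, hc2⟩ := hsep (α v) (hαQ v) (α w + n) qα (by linarith) (by linarith)
        (by linarith) (by linarith) (by linarith)
      obtain ⟨d, hd1, hd2⟩ := hsep (β v) (hβQ v) (β w + n) qβ (by linarith) (by linarith)
        (by linarith) (by linarith) (by linarith)
      have hvc : v ≠ c := by rintro rfl; exact hc2 Vw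
      have hvd : v ≠ d := by rintro rfl; exact hd2 Vw'
      obtain ⟨kc, hkc1, hkc2⟩ := id hc1
      obtain ⟨kd, hkd1, hkd2⟩ := id hd1
      have hcw : b c ≤ α w + n + kc := by
        by_contra h
        exact hc2 ⟨kc, by linarith, by linarith⟩
      have hdw : β w + n + kd ≤ a d := by
        by_contra h
        exact hd2 ⟨kd, by linarith, by linarith⟩
      -- points of `c` (resp. `d`) inside the lift of `v` are on the left (resp. right) of `w`
      have cl : ∀ p, a v < p → p < b v → OnArc a b c p → p < α w + n := by
        rintro p h1 h2 ⟨m, h3, h4⟩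
        have := shift_eq_zero hN hvc (by linarith) (by linarith) hkc1 hkc2 h1 h2 h3 h4
        subst this
        linarith
      have dl : ∀ p, a v < p → p < b v → OnArc a b d p → β w + n < p := by
        rintro p h1 h2 ⟨m, h3, h4⟩
        have := shift_eq_zero hN hvd (by linarith) (by linarith) hkd1 hkd2 h1 h2 h3 h4
        subst this
        linarith
      -- common points with `w` may be moved to `Q`, and then into the lift
      have wl : ∀ e, (∃ p, OnArc a b w p ∧ OnArc a b e p) →
          ∃ q, α w + n ≤ q ∧ q ≤ β w + n ∧ OnArc a b e q := by
        rintro e ⟨p, h1, h2⟩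
        obtain ⟨q, hq, h⟩ := hQ1 p
        obtain ⟨m, hm1, hm2⟩ := h w h1
        have mm : q + m ∈ Q ∩ Set.Ioo (a w) (b w) := ⟨hQ2 q hq m, hm1, hm2⟩
        refine ⟨q + m + n, by linarith [hα2 w _ mm], by linarith [hβ2 w _ mm], ?_⟩
        rw [onArc_add_int, onArc_add_int]
        exact h e h2
      refine hC v c w d ⟨_, Vα, hc1⟩ ⟨_, Vw, Ww⟩ ⟨_, Vβ, hd1⟩ ?_ ?_ ?_
      · rintro ⟨p, h1, h2⟩
        obtain ⟨q, i1, i2, i3⟩ := wl c ⟨p, h2, h1⟩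
        linarith [cl q (by linarith) (by linarith) i3]
      · rintro ⟨p, h1, h2⟩
        obtain ⟨r, hr⟩ := hH {v, c, d} (by
          have self : ∀ u, ∃ p, OnArc a b u p ∧ OnArc a b u p := fun u =>
            ⟨α u, ⟨0, by simpa using hαa u, by simpa using hαb u⟩,
              ⟨0, by simpa using hαa u, by simpa using hαb u⟩⟩
          rintro u (rfl | rfl | rfl) u' (rfl | rfl | rfl)
          · exact self _
          · exact ⟨_, Vα, hc1⟩
          · exact ⟨_, Vβ, hd1⟩
          · exact ⟨_, hc1, Vα⟩
          · exact self _
          · exact ⟨_, h1, h2⟩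
          · exact ⟨_, hd1, Vβ⟩
          · exact ⟨_, h2, h1⟩
          · exact self _)
        obtain ⟨m, hm1, hm2⟩ := hr v (by simp)
        have j1 := cl (r + m) hm1 hm2 ((onArc_add_int m).2 (hr c (by simp)))
        have j2 := dl (r + m) hm1 hm2 ((onArc_add_int m).2 (hr d (by simp)))
        linarith
      · intro h
        obtain ⟨q, i1, i2, i3⟩ := wl d h
        linarith [dl q (by linarith) (by linarith) i3]

theorem claw_of_rel {V : Type} (G : SimpleGraph V) (R : V → V → Prop)
    (hM : ∀ u v, G.Adj u v ↔ u ≠ v ∧ R u v)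
    (hself : ∀ v, R v v) (hsymm : ∀ u v, R u v → R v u) (hcl : IsEmpty (claw ↪g G))
    {v c w d : V} (h1 : R v c) (h2 : R v w) (h3 : R v d) (n1 : ¬ R c w) (n2 : ¬ R c d)
    (n3 : ¬ R w d) : False := by
  have n1' : ¬ R w c := fun h => n1 (hsymm _ _ h)
  have n2' : ¬ R d c := fun h => n2 (hsymm _ _ h)
  have n3' : ¬ R d w := fun h => n3 (hsymm _ _ h)
  have h1' := hsymm _ _ h1
  have h2' := hsymm _ _ h2
  have h3' := hsymm _ _ h3
  have d1 : v ≠ c := by rintro rfl; exact n1 h2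
  have d2 : v ≠ w := by rintro rfl; exact n3 h3
  have d3 : v ≠ d := by rintro rfl; exact n3' h2
  have d4 : c ≠ w := by rintro rfl; exact n1 (hself _)
  have d5 : c ≠ d := by rintro rfl; exact n2 (hself _)
  have d6 : w ≠ d := by rintro rfl; exact n3 (hself _)
  apply hcl.false
  refine ⟨⟨![v, c, w, d], ?_⟩, ?_⟩
  · intro i j hij
    fin_cases i <;> fin_cases j <;> simp [d1, d2, d3, d4, d5, d6, d1.symm, d2.symm, d3.symm,
      d4.symm, d5.symm, d6.symm] at hij ⊢
  · intro i j
    change G.Adj (![v, c, w, d] i) (![v, c, w, d] j) ↔ _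
    rw [hM, claw, SimpleGraph.fromRel_adj]
    fin_cases i <;> fin_cases j <;> simp [d1, d2, d3, d1.symm, d2.symm, d3.symm,
      h1, h2, h3, h1', h2', h3', n1, n2, n3, n1', n2', n3']

theorem claw_free_proper {V : Type} [Fintype V] (G : SimpleGraph V) (hG : IsNHCAGraph G)
    (hcl : IsEmpty (claw ↪g G)) : IsPHCAGraph G := by
  obtain ⟨M, hN, hH, hM⟩ := hG
  obtain ⟨a, b, hab, hb, hpts, -, -⟩ := exists_lift_aux M
  have hI := inter_iff_aux M a b hpts
  have hself : ∀ v, ∃ p, OnArc a b v p ∧ OnArc a b v p := fun v =>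
    have : OnArc a b v ((a v + b v) / 2) :=
      ⟨0, by push_cast; linarith [hab v], by push_cast; linarith [hab v]⟩
    ⟨_, this, this⟩
  have hsymm : ∀ u v, (∃ p, OnArc a b u p ∧ OnArc a b v p) →
      ∃ p, OnArc a b v p ∧ OnArc a b u p := fun u v ⟨p, h1, h2⟩ => ⟨p, h2, h1⟩
  obtain ⟨x, y, hxy, hy, hxx, hyy, hxyn, hint, hhel, hprop⟩ := core_s4 a b hab hb
    (by
      intro u v huv
      obtain ⟨z, hz⟩ := (Set.ne_univ_iff_exists_notMem _).1 (hN u v huv)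
      obtain ⟨p, rfl⟩ := QuotientAddGroup.mk_surjective z
      exact ⟨p, fun h => hz (Or.inl ((hpts u p).2 h)), fun h => hz (Or.inr ((hpts v p).2 h))⟩)
    (by
      intro S hS
      obtain ⟨z, hz⟩ := hH S (fun u hu v hv => (hI u v).2 (hS u hu v hv))
      obtain ⟨p, rfl⟩ := QuotientAddGroup.mk_surjective z
      exact ⟨p, fun v hv => (hpts v p).1 (hz v hv)⟩)
    (by
      intro v c w d h1 h2 h3 n1 n2 n3
      exact claw_of_rel G (fun u v => ∃ p, OnArc a b u p ∧ OnArc a b v p)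
        (fun u v => by rw [hM, hI]) hself hsymm hcl h1 h2 h3 n1 n2 n3)
  have hmem : ∀ v (p : ℝ), sbtw (x v : Circ) (p : Circ) (y v : Circ) ↔ OnArc x y v p :=
    fun v p => sbtw_coe_iff_aux (hxy v) (hy v)
  let M' : CAModel V :=
    { arc := fun v => ⟨(x v : Circ), (y v : Circ)⟩
      endpoints_distinct := by
        rintro ⟨v, i⟩ ⟨w, j⟩ h
        cases i <;> cases j <;> simp only [if_true, if_false, Bool.false_eq_true] at h
        · obtain ⟨n, hn⟩ := coe_eq_coe_aux.1 h
          rw [hyy v w n hn]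
        · obtain ⟨n, hn⟩ := coe_eq_coe_aux.1 h.symm
          exact (hxyn _ _ n hn).elim
        · obtain ⟨n, hn⟩ := coe_eq_coe_aux.1 h
          exact (hxyn _ _ n hn).elim
        · obtain ⟨n, hn⟩ := coe_eq_coe_aux.1 h
          rw [hxx v w n hn] }
  have hpts' : ∀ v (p : ℝ), (p : Circ) ∈ (M'.arc v).pts ↔ OnArc x y v p := hmem
  have hI' := inter_iff_aux M' x y hpts'
  refine ⟨M', ?_, ?_, ?_⟩
  · intro w v hwv hsub
    have hsub' : ∀ p, OnArc x y w p → OnArc x y v p := fun p hp =>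
      (hpts' v p).1 (hsub.1 ((hpts' w p).2 hp))
    obtain ⟨n, h1, h2⟩ := hsub' ((x w + y w) / 2)
      ⟨0, by push_cast; linarith [hxy w], by push_cast; linarith [hxy w]⟩
    refine hprop v w hwv.symm n ?_ ?_
    · by_contra hc
      have := hsub' (x v + ((-n : ℤ) : ℝ)) ⟨0, by push_cast; linarith, by push_cast; linarith⟩
      exact not_onArc_left (hy v) (-n) this
    · by_contra hc
      have := hsub' (y v + ((-n : ℤ) : ℝ)) ⟨0, by push_cast; linarith, by push_cast; linarith⟩
      exact not_onArc_right (hy v) (-n) this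
  · intro S hS
    obtain ⟨p, hp⟩ := hhel S (fun u hu v hv => (hI' u v).1 (hS u hu v hv))
    exact ⟨p, fun v hv => (hpts' v p).2 (hp v hv)⟩
  · intro u v
    rw [hM, hI', hint, hI]

/-- An NHCA graph is a PHCA graph iff it contains no induced `K_{1,3}`. -/
theorem stmt_4 {V : Type} [Fintype V] (G : SimpleGraph V) (hG : IsNHCAGraph G) :
    IsPHCAGraph G ↔ IsEmpty (claw ↪g G) := by
  constructor
  · rintro ⟨M, hP, -, hM⟩
    exact proper_claw_free G M hP hM
  · exact claw_free_proper G hG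
end
end
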